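/- Assume (A3) and (A6). Let g₋ : Ī → ℝ be bounded, left-continuous and of bounded variation, let g₊ : Ī → ℝ be bounded, right-continuous and of bounded variation, and let h₋, h₊ : Ī → ℝ be bounded functions of bounded variation, h₋ left-continuous and h₊ right-continuous, with dh₋ = −λ₋ dg₋ and dh₊ = −λ₊ dg₊. Then there exists a unique pair (w₋, w₊), with w₋ bounded left-continuous of bounded variation, w₊ bounded right-continuous of bounded variation, and w₋(I₋) = 0 = w₊(I₊), satisfying (i) w₊ dλ₊ + d(λ₊ w₋) = −dg₋ and (ii) w₋ dλ₋ + d(λ₋ w₊) = −dg₊. It is given by w₋(x) = ∫_{[I₋,x)} { ((κ + h₊)/λ₋) d(1/λ₊) + (1/λ₋) d(h₋/λ₊) } and w₊(x) = −∫_{(x,I₊]} { ((κ + h₋)/λ₊) d(1/λ₋) + (1/λ₊) d(h₊/λ₋) }, where κ := Γ⁻¹ [ ∫_{Ī} { (h₊/λ₋) d(1/λ₊) + (1/λ₋) d(h₋/λ₊) } − (h₋(I₊) + h₊(I₊))/(λ₋(I₊)λ₊(I₊)) ]. -/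

import Mathlib

open MeasureTheory Set
open scoped ENNReal

noncomputable section

/-- The right limit of `f` at `x`, with the convention `f(b+) := f b` at the
right endpoint `b`. -/
def rLim (b : ℝ) (f : ℝ → ℝ) (x : ℝ) : ℝ :=
  if x < b then Function.rightLim f x else f b

/-- `ν` is the Lebesgue-Stieltjes signed measure `df` of `f` on the interval `[a,b]`,
with the conventions `f(a−) := f a` and `f(b+) := f b`. -/
def IsLS (a b : ℝ) (f : ℝ → ℝ) (ν : MeasureTheory.SignedMeasure ℝ) : Prop :=
  (∀ s : Set ℝ, MeasurableSet s → s ∩ Set.Icc a b = ∅ → ν s = 0) ∧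
  (∀ x y : ℝ, a ≤ x → x ≤ y → y ≤ b → ν (Set.Ioc x y) = rLim b f y - rLim b f x) ∧
  ν {a} = rLim b f a - f a

/-- The integral `∫_s g dν` of `g` over `s` against the signed measure `ν`. -/
def sInt (ν : MeasureTheory.SignedMeasure ℝ) (g : ℝ → ℝ) (s : Set ℝ) : ℝ :=
  (∫ x in s, g x ∂ν.toJordanDecomposition.posPart) -
    ∫ x in s, g x ∂ν.toJordanDecomposition.negPart

/-- Assumption (A3): `lm` (demand) is continuous and nonincreasing, `lp` (supply) is
continuous and nondecreasing on `[a,b]`; both are nonnegative. -/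
def A3 (a b : ℝ) (lm lp : ℝ → ℝ) : Prop :=
  ContinuousOn lm (Set.Icc a b) ∧ ContinuousOn lp (Set.Icc a b) ∧
  AntitoneOn lm (Set.Icc a b) ∧ MonotoneOn lp (Set.Icc a b) ∧
  (∀ x ∈ Set.Icc a b, 0 ≤ lm x) ∧ (∀ x ∈ Set.Icc a b, 0 ≤ lp x)

/-- Assumption (A6): the rates of market orders are positive. -/
def A6 (a b : ℝ) (lm lp : ℝ → ℝ) : Prop := 0 < lp a ∧ 0 < lm b

/-- An admissible pair of weight functions: bounded, of bounded variation, `wm`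
left-continuous, `wp` right-continuous, with `wm a = 0` and `wp b = 0`. -/
def WPair (a b : ℝ) (wm wp : ℝ → ℝ) : Prop :=
  (∃ C, ∀ x ∈ Set.Icc a b, |wm x| ≤ C) ∧ (∃ C, ∀ x ∈ Set.Icc a b, |wp x| ≤ C) ∧
  BoundedVariationOn wm (Set.Icc a b) ∧ BoundedVariationOn wp (Set.Icc a b) ∧
  (∀ x ∈ Set.Ioc a b, ContinuousWithinAt wm (Set.Iio x) x) ∧
  (∀ x ∈ Set.Ico a b, ContinuousWithinAt wp (Set.Ioi x) x) ∧
  wm a = 0 ∧ wp b = 0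

/-- The constant `Γ`, computed from the Lebesgue-Stieltjes measure `νip` of `1/λ₊`. -/
def Gam (a b : ℝ) (lm lp : ℝ → ℝ) (νip : MeasureTheory.SignedMeasure ℝ) : ℝ :=
  (lm b * lp b)⁻¹ - sInt νip (fun x => (lm x)⁻¹) (Set.Icc a b)

/-- The function `u₋₊`, where `νip` is the Lebesgue-Stieltjes measure of `1/λ₊`. -/
def ump (a b : ℝ) (lm lp : ℝ → ℝ) (νip : MeasureTheory.SignedMeasure ℝ) (x : ℝ) : ℝ :=
  (Gam a b lm lp νip)⁻¹ *
    ((lm b * lp b)⁻¹ - sInt νip (fun t => (lm t)⁻¹) (Set.Ioc x b))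

/-- The function `u₊₋`, where `νim` is the Lebesgue-Stieltjes measure of `1/λ₋`. -/
def upm (a b : ℝ) (lm lp : ℝ → ℝ) (νip νim : MeasureTheory.SignedMeasure ℝ) (x : ℝ) : ℝ :=
  (Gam a b lm lp νip)⁻¹ *
    ((lm a * lp a)⁻¹ + sInt νim (fun t => (lp t)⁻¹) (Set.Ioc a x))

/-- The pair `(wm, wp)` is an admissible solution of the differential equations
`wp dλ₊ + d(λ₊ wm) = −dgm` and `wm dλ₋ + d(λ₋ wp) = −dgp` with boundary conditions
`wm a = 0 = wp b`. -/
def InvEq (a b : ℝ) (lm lp : ℝ → ℝ) (νlm νlp νgm νgp : MeasureTheory.SignedMeasure ℝ)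
    (wm wp : ℝ → ℝ) : Prop :=
  WPair a b wm wp ∧
  ∀ νpwm νmwp : MeasureTheory.SignedMeasure ℝ,
    IsLS a b (fun x => lp x * wm x) νpwm → IsLS a b (fun x => lm x * wp x) νmwp →
    ∀ s : Set ℝ, MeasurableSet s →
      sInt νlp wp s + νpwm s = - νgm s ∧ sInt νlm wm s + νmwp s = - νgp s

section LebesgueStieltjes

open Filter Topology

variable {a b : ℝ} {μ : Measure ℝ}

theorem BoundedVariationOn.exists_monotoneOn_Icc {f : ℝ → ℝ}
    (hf : BoundedVariationOn f (Icc a b)) :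
    ∃ p q : ℝ → ℝ, MonotoneOn p (Icc a b) ∧ MonotoneOn q (Icc a b) ∧ f = p - q :=
  hf.locallyBoundedVariationOn.exists_monotoneOn_sub_monotoneOn

theorem BoundedVariationOn.neg_Icc {f : ℝ → ℝ} (hf : BoundedVariationOn f (Icc a b)) :
    BoundedVariationOn (fun x => -f x) (Icc a b) := by
  have h : BoundedVariationOn (fun _ : ℝ => (-1 : ℝ)) (Icc a b) := by
    unfold BoundedVariationOn
    rw [eVariationOn.constant_on]
    · simp
    · rintro _ ⟨x, _, rfl⟩ _ ⟨y, _, rfl⟩; rfl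
  have h2 := h.mul hf
  convert h2 using 1
  ext x; simp

theorem MonotoneOn.boundedVariationOn_Icc {f : ℝ → ℝ} (hf : MonotoneOn f (Icc a b)) :
    BoundedVariationOn f (Icc a b) := by
  refine hf.boundedVariationOn (C := max |f a| |f b|) fun x hx => ?_
  have hab := hx.1.trans hx.2
  exact abs_le_max_abs_abs (hf (left_mem_Icc.2 hab) hx hx.1) (hf hx (right_mem_Icc.2 hab) hx.2)

theorem AntitoneOn.boundedVariationOn_Icc {f : ℝ → ℝ} (hf : AntitoneOn f (Icc a b)) :
    BoundedVariationOn f (Icc a b) := by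
  have h := (MonotoneOn.boundedVariationOn_Icc (f := fun x => -f x) hf.neg).neg_Icc
  simpa using h

theorem BoundedVariationOn.add_Icc {f g : ℝ → ℝ} (hf : BoundedVariationOn f (Icc a b))
    (hg : BoundedVariationOn g (Icc a b)) : BoundedVariationOn (fun x => f x + g x) (Icc a b) := by
  refine ne_top_of_le_ne_top (ENNReal.add_ne_top.2 ⟨hf, hg⟩) (iSup_le fun p => ?_)
  calc _ ≤ ∑ i ∈ Finset.range p.1, (edist (f (p.2.1 (i + 1))) (f (p.2.1 i)) +
        edist (g (p.2.1 (i + 1))) (g (p.2.1 i))) :=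
        Finset.sum_le_sum fun i _ => edist_add_add_le _ _ _ _
    _ ≤ _ := by
      rw [Finset.sum_add_distrib]
      exact add_le_add (eVariationOn.sum_le p.2.2.1 p.2.2.2) (eVariationOn.sum_le p.2.2.1 p.2.2.2)

theorem BoundedVariationOn.exists_abs_le_Icc {f : ℝ → ℝ} (hf : BoundedVariationOn f (Icc a b)) :
    ∃ C, ∀ x ∈ Icc a b, |f x| ≤ C := by
  refine ⟨|f a| + (eVariationOn f (Icc a b)).toReal, fun x hx => ?_⟩
  have h := hf.dist_le hx (left_mem_Icc.2 (hx.1.trans hx.2))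
  rw [Real.dist_eq] at h
  have := abs_sub_abs_le_abs_sub (f x) (f a)
  linarith

theorem BoundedVariationOn.countable_discontinuities {f : ℝ → ℝ}
    (hf : BoundedVariationOn f (Icc a b)) :
    {x | x ∈ Icc a b ∧ ¬ContinuousWithinAt f (Icc a b) x}.Countable := by
  obtain ⟨p, q, hp, hq, rfl⟩ := hf.exists_monotoneOn_Icc
  refine (hp.countable_not_continuousWithinAt.union hq.countable_not_continuousWithinAt).mono ?_
  rintro x ⟨hx, hc⟩
  by_contra h
  simp only [mem_union, mem_ofPred_eq, not_or, not_and, not_not] at h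
  exact hc ((h.1 hx).sub (h.2 hx))

theorem BoundedVariationOn.aestronglyMeasurable_Icc {f : ℝ → ℝ}
    (hf : BoundedVariationOn f (Icc a b)) (hμ : μ (Icc a b)ᶜ = 0) :
    AEStronglyMeasurable f μ := by
  obtain ⟨p, q, hp, hq, rfl⟩ := hf.exists_monotoneOn_Icc
  have h : μ.restrict (Icc a b) = μ := Measure.restrict_eq_self_of_ae_mem (by rwa [ae_iff])
  have h1 := aemeasurable_restrict_of_monotoneOn (μ := μ) measurableSet_Icc hp
  have h2 := aemeasurable_restrict_of_monotoneOn (μ := μ) measurableSet_Icc hq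
  rw [h] at h1 h2
  exact (h1.sub h2).aestronglyMeasurable

theorem MeasureTheory.Integrable.bv_mul {f φ : ℝ → ℝ} (hφ : Integrable φ μ)
    (hf : BoundedVariationOn f (Icc a b)) (hμ : μ (Icc a b)ᶜ = 0) :
    Integrable (fun x => f x * φ x) μ := by
  obtain ⟨C, hC⟩ := hf.exists_abs_le_Icc
  refine hφ.bdd_mul (c := C) (hf.aestronglyMeasurable_Icc hμ) ?_
  have : ∀ᵐ x ∂μ, x ∈ Icc a b := by rwa [ae_iff]
  filter_upwards [this] with x hx using hC x hx

theorem BoundedVariationOn.tendsto_rLim {f : ℝ → ℝ} (hf : BoundedVariationOn f (Icc a b)) {x : ℝ}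
    (hx : x ∈ Ico a b) : Tendsto f (𝓝[>] x) (𝓝 (rLim b f x)) := by
  obtain ⟨l, hl⟩ := hf.exists_tendsto_right x
  have hs : 𝓝[Icc a b ∩ Ioi x] x = 𝓝[>] x := by
    refine le_antisymm (nhdsWithin_mono _ inter_subset_right) ?_
    refine le_inf (nhdsWithin_le_nhds) (le_principal_iff.2 ?_)
    filter_upwards [Ioo_mem_nhdsGT hx.2] with y hy
    exact ⟨⟨hx.1.trans hy.1.le, hy.2.le⟩, hy.1⟩
  rw [hs] at hl
  simp only [rLim, hx.2, if_true]
  exact tendsto_rightLim_of_tendsto ⟨l, hl⟩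

theorem rLim_eq_of_tendsto {f : ℝ → ℝ} {x l : ℝ} (hx : x < b) (h : Tendsto f (𝓝[>] x) (𝓝 l)) :
    rLim b f x = l := by
  simp only [rLim, hx, if_true]
  exact rightLim_eq_of_tendsto h

@[simp] theorem rLim_right (f : ℝ → ℝ) : rLim b f b = f b := by simp [rLim]

theorem rLim_eq_self {f : ℝ → ℝ}
    (hf : ∀ x ∈ Ico a b, ContinuousWithinAt f (Ioi x) x) {x : ℝ} (hx : x ∈ Icc a b) :
    rLim b f x = f x := by
  rcases hx.2.eq_or_lt with rfl | h
  · simp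
  · exact rLim_eq_of_tendsto h (hf x ⟨hx.1, h⟩)

theorem nhdsGT_le_nhdsWithin_Icc {x : ℝ} (hx : x ∈ Ico a b) : 𝓝[>] x ≤ 𝓝[Icc a b] x := by
  refine le_inf nhdsWithin_le_nhds (le_principal_iff.2 ?_)
  filter_upwards [Ioo_mem_nhdsGT hx.2] with y hy
  exact ⟨hx.1.trans hy.1.le, hy.2.le⟩

theorem nhdsLT_le_nhdsWithin_Icc {x : ℝ} (hx : x ∈ Ioc a b) : 𝓝[<] x ≤ 𝓝[Icc a b] x := by
  refine le_inf nhdsWithin_le_nhds (le_principal_iff.2 ?_)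
  filter_upwards [Ioo_mem_nhdsLT hx.1] with y hy
  exact ⟨hy.1.le, hy.2.le.trans hx.2⟩

theorem ContinuousOn.continuousWithinAt_Ioi_Ico {f : ℝ → ℝ} (hf : ContinuousOn f (Icc a b)) :
    ∀ x ∈ Ico a b, ContinuousWithinAt f (Ioi x) x := fun x hx =>
  (hf x ⟨hx.1, hx.2.le⟩).mono_left (nhdsGT_le_nhdsWithin_Icc hx)

theorem ContinuousOn.continuousWithinAt_Iio_Ioc {f : ℝ → ℝ} (hf : ContinuousOn f (Icc a b)) :
    ∀ x ∈ Ioc a b, ContinuousWithinAt f (Iio x) x := fun x hx =>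
  (hf x ⟨hx.1.le, hx.2⟩).mono_left (nhdsLT_le_nhdsWithin_Icc hx)

theorem rLim_mul {f g : ℝ → ℝ} (hf : BoundedVariationOn f (Icc a b))
    (hg : BoundedVariationOn g (Icc a b)) {x : ℝ} (hx : x ∈ Icc a b) :
    rLim b (fun t => f t * g t) x = rLim b f x * rLim b g x := by
  rcases hx.2.eq_or_lt with rfl | h
  · simp
  · exact rLim_eq_of_tendsto h ((hf.tendsto_rLim ⟨hx.1, h⟩).mul (hg.tendsto_rLim ⟨hx.1, h⟩))

theorem MeasureTheory.SignedMeasure.apply_inter_of_null_compl {ν : SignedMeasure ℝ} {t : Set ℝ}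
    (ht : MeasurableSet t)
    (h : ∀ s, MeasurableSet s → s ∩ t = ∅ → ν s = 0) {s : Set ℝ} (hs : MeasurableSet s) :
    ν s = ν (s ∩ t) := by
  have h1 : s = (s ∩ t) ∪ (s \ t) := (inter_union_sdiff s t).symm
  conv_lhs => rw [h1]
  rw [VectorMeasure.of_union (disjoint_sdiff_inter.symm) (hs.inter ht) (hs.diff ht),
    h (s \ t) (hs.diff ht) (by ext; simp), add_zero]

theorem IsLS.unique {f : ℝ → ℝ} {ν ν' : SignedMeasure ℝ} (hab : a ≤ b) (h : IsLS a b f ν)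
    (h' : IsLS a b f ν') : ν = ν' := by
  have hIoc : ∀ x y, a ≤ x → y ≤ b → ν (Ioc x y) = ν' (Ioc x y) := by
    intro x y hx hy
    rcases le_or_gt x y with hxy | hxy
    · rw [h.2.1 x y hx hxy hy, h'.2.1 x y hx hxy hy]
    · simp [Ioc_eq_empty_of_le hxy.le]
  have hIcc : ∀ y, a ≤ y → y ≤ b → ν (Icc a y) = ν' (Icc a y) := by
    intro y hay hy
    have hd : Disjoint {a} (Ioc a y) := by simp
    rw [← Icc_union_Ioc_eq_Icc le_rfl hay, Icc_self,
      VectorMeasure.of_union hd (measurableSet_singleton a) measurableSet_Ioc,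
      VectorMeasure.of_union hd (measurableSet_singleton a) measurableSet_Ioc,
      h.2.2, h'.2.2, hIoc a y le_rfl hy]
  refine VectorMeasure.ext_of_generateFrom {S | ∃ l u, l < u ∧ Ioc l u = S} ?_
    ((BorelSpace.measurable_eq).trans (borel_eq_generateFrom_Ioc ℝ)) (isPiSystem_Ioc id id) ?_
  · rintro _ ⟨l, u, _, rfl⟩
    rw [SignedMeasure.apply_inter_of_null_compl measurableSet_Icc h.1 measurableSet_Ioc,
      SignedMeasure.apply_inter_of_null_compl measurableSet_Icc h'.1 measurableSet_Ioc]
    rcases lt_or_ge l a with hl | hl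
    · rcases lt_or_ge u a with hu | hu
      · have : Ioc l u ∩ Icc a b = ∅ := by
          ext x; simp only [mem_inter_iff, mem_Ioc, mem_Icc, mem_empty_iff_false, iff_false]
          rintro ⟨⟨_, h1⟩, h2, _⟩; linarith
        simp [this]
      · have : Ioc l u ∩ Icc a b = Icc a (min u b) := by
          ext x; simp only [mem_inter_iff, mem_Ioc, mem_Icc, le_min_iff]
          exact ⟨fun h => ⟨h.2.1, h.1.2, h.2.2⟩, fun h => ⟨⟨hl.trans_le h.1, h.2.1⟩, h.1, h.2.2⟩⟩
        rw [this]
        exact hIcc _ (le_min hu hab) (min_le_right _ _)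
    · have : Ioc l u ∩ Icc a b = Ioc l (min u b) := by
        ext x; simp only [mem_inter_iff, mem_Ioc, mem_Icc, le_min_iff]
        exact ⟨fun h => ⟨h.1.1, h.1.2, h.2.2⟩, fun h => ⟨⟨h.1, h.2.1⟩, hl.trans h.1.le, h.2.2⟩⟩
      rw [this]
      exact hIoc _ _ hl (min_le_right _ _)
  · rw [SignedMeasure.apply_inter_of_null_compl measurableSet_Icc h.1 MeasurableSet.univ,
      SignedMeasure.apply_inter_of_null_compl measurableSet_Icc h'.1 MeasurableSet.univ,
      univ_inter]
    exact hIcc b hab le_rfl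

/-- The integral of the density of a signed measure reproduces the integral `sInt`. -/
theorem sInt_withDensity {φ g : ℝ → ℝ} (hφm : Measurable φ) (hφ : Integrable φ μ)
    (hg : Integrable (fun x => g x * φ x) μ) {s : Set ℝ} (hs : MeasurableSet s) :
    sInt (μ.withDensityᵥ φ) g s = ∫ x in s, g x * φ x ∂μ := by
  have hJ := SignedMeasure.toJordanDecomposition_eq_of_eq_add_withDensity (t := 0) hφm hφ
    (VectorMeasure.MutuallySingular.zero_left) (zero_add (μ.withDensityᵥ φ)).symm
  have key : ∀ ψ : ℝ → ℝ, Measurable ψ → 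
      ∫ x in s, g x ∂(μ.withDensity fun x => ENNReal.ofReal (ψ x)) =
        ∫ x in s, max (ψ x) 0 * g x ∂μ := by
    intro ψ hψ
    rw [restrict_withDensity hs]
    simp only [ENNReal.ofReal]
    rw [integral_withDensity_eq_integral_smul hψ.real_toNNReal]
    simp [NNReal.smul_def]
  have hadd : ∀ ψ : ℝ → ℝ, Measurable ψ → Integrable (fun x => g x * ψ x) μ →
      Integrable (fun x => max (ψ x) 0 * g x) μ := by
    intro ψ hψ h
    have : (fun x => max (ψ x) 0 * g x) = {x | 0 < ψ x}.indicator (fun x => g x * ψ x) := by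
      ext x
      by_cases hx : 0 < ψ x
      · simp [indicator, hx, hx.le, mul_comm]
      · simp [indicator, hx, not_lt.1 hx]
    rw [this]
    exact h.indicator (measurableSet_lt measurable_const hψ)
  unfold sInt
  rw [hJ]
  simp only [SignedMeasure.toJordanDecomposition_zero, JordanDecomposition.zero_posPart,
    JordanDecomposition.zero_negPart, zero_add]
  rw [key φ hφm, key (fun x => -φ x) hφm.neg, ← integral_sub (hadd φ hφm hg).integrableOn
    (hadd (fun x => -φ x) hφm.neg (by simpa using hg.neg)).integrableOn]
  congr 1; ext x
  rw [← sub_mul, mul_comm]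
  congr 1
  rcases le_total 0 (φ x) with h | h <;> simp [h]

theorem BoundedVariationOn.exists_isLS {f : ℝ → ℝ} (hab : a < b)
    (hf : BoundedVariationOn f (Icc a b)) : ∃ ν : SignedMeasure ℝ, IsLS a b f ν := by
  set F : ℝ → ℝ := f ∘ fun x => max a (min b x) with hF
  have hFf : ∀ x ∈ Icc a b, F x = f x := fun x hx => by
    simp [hF, min_eq_right hx.2, max_eq_right hx.1]
  have hbv : BoundedVariationOn F univ := by
    refine ne_top_of_le_ne_top hf (eVariationOn.comp_le_of_monotoneOn f _ ?_ ?_)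
    · intro x _ y _ hxy
      exact max_le_max le_rfl (min_le_min le_rfl hxy)
    · intro x _
      exact ⟨le_max_left _ _, max_le hab.le (min_le_left _ _)⟩
  have hr : ∀ x ∈ Icc a b, Function.rightLim F x = rLim b f x := by
    intro x hx
    rcases hx.2.eq_or_lt with rfl | h
    · rw [rLim_right]
      refine rightLim_eq_of_tendsto (tendsto_const_nhds.congr' ?_)
      filter_upwards [self_mem_nhdsWithin] with y hy
      simp [hF, min_eq_left (le_of_lt (mem_Ioi.1 hy)), hab.le]
    · refine rightLim_eq_of_tendsto ((hf.tendsto_rLim ⟨hx.1, h⟩).congr' ?_)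
      filter_upwards [Ioo_mem_nhdsGT h] with y hy
      exact (hFf y ⟨hx.1.trans hy.1.le, hy.2.le⟩).symm
  have hl : Function.leftLim F a = f a := by
    refine leftLim_eq_of_tendsto (tendsto_const_nhds.congr' ?_)
    filter_upwards [self_mem_nhdsWithin] with y hy
    have : y < a := hy
    simp [hF, min_eq_right (this.trans hab).le, this.le]
  refine ⟨hbv.vectorMeasure.restrict (Icc a b), ?_, ?_, ?_⟩
  · intro s hs hsI
    rw [VectorMeasure.restrict_apply _ measurableSet_Icc hs, hsI, VectorMeasure.empty]
  · intro x y hx hxy hy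
    rw [VectorMeasure.restrict_apply _ measurableSet_Icc measurableSet_Ioc,
      inter_eq_left.2 (show Ioc x y ⊆ Icc a b from
        fun t ht => ⟨hx.trans ht.1.le, ht.2.trans hy⟩), hbv.vectorMeasure_Ioc hxy,
      hr y ⟨hx.trans hxy, hy⟩, hr x ⟨hx, hxy.trans hy⟩]
  · rw [VectorMeasure.restrict_apply _ measurableSet_Icc (measurableSet_singleton a),
      inter_eq_left.2 (by simp [hab.le]), hbv.vectorMeasure_singleton, hl,
      hr a ⟨le_rfl, hab.le⟩]

theorem tendsto_setIntegral_of_eventually_mem_iff {ι : Type*} {l : Filter ι}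
    [l.IsCountablyGenerated] {φ : ℝ → ℝ} (hφ : Integrable φ μ) {S : ι → Set ℝ} {T : Set ℝ}
    (hS : ∀ i, MeasurableSet (S i)) (hT : MeasurableSet T)
    (h : ∀ x, ∀ᶠ i in l, (x ∈ S i ↔ x ∈ T)) :
    Tendsto (fun i => ∫ x in S i, φ x ∂μ) l (𝓝 (∫ x in T, φ x ∂μ)) := by
  simp_rw [← integral_indicator (hS _), ← integral_indicator hT]
  refine tendsto_integral_filter_of_dominated_convergence (fun x => ‖φ x‖)
    (Eventually.of_forall fun i => (hφ.indicator (hS i)).aestronglyMeasurable)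
    (Eventually.of_forall fun i => Eventually.of_forall fun x => norm_indicator_le_norm_self _ _)
    hφ.norm (Eventually.of_forall fun x => tendsto_const_nhds.congr' ?_)
  filter_upwards [h x] with i hi
  by_cases hx : x ∈ T
  · simp [hx, hi.2 hx]
  · have hxS : x ∉ S i := fun h => hx (hi.1 h)
    simp [hx, hxS]

/-- `f` has bounded variation on `[a, b]` and its Lebesgue-Stieltjes measure has density `φ`
with respect to `μ`. -/
structure HasLSDensity (a b : ℝ) (μ : Measure ℝ) (f φ : ℝ → ℝ) : Prop where
  bv : BoundedVariationOn f (Icc a b)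
  int : Integrable φ μ
  ioc : ∀ x y : ℝ, a ≤ x → x ≤ y → y ≤ b → ∫ t in Ioc x y, φ t ∂μ = rLim b f y - rLim b f x
  sing : ∫ t in {a}, φ t ∂μ = rLim b f a - f a

namespace HasLSDensity

variable {f g φ ψ : ℝ → ℝ}

theorem isLS (h : HasLSDensity a b μ f φ) (hμ : μ (Icc a b)ᶜ = 0) :
    IsLS a b f (μ.withDensityᵥ φ) := by
  refine ⟨fun s hs hsI => ?_, fun x y hx hxy hy => ?_, ?_⟩
  · rw [withDensityᵥ_apply h.int hs]
    have : μ s = 0 := measure_mono_null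
      (disjoint_iff_inter_eq_empty.2 hsI).subset_compl_right hμ
    exact setIntegral_measure_zero _ this
  · rw [withDensityᵥ_apply h.int measurableSet_Ioc, h.ioc x y hx hxy hy]
  · rw [withDensityᵥ_apply h.int (measurableSet_singleton a), h.sing]

theorem of_isLS (hf : BoundedVariationOn f (Icc a b)) (hφ : Integrable φ μ)
    (h : IsLS a b f (μ.withDensityᵥ φ)) : HasLSDensity a b μ f φ := by
  refine ⟨hf, hφ, fun x y hx hxy hy => ?_, ?_⟩
  · rw [← h.2.1 x y hx hxy hy, withDensityᵥ_apply hφ measurableSet_Ioc]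
  · rw [← h.2.2, withDensityᵥ_apply hφ (measurableSet_singleton a)]

theorem icc (h : HasLSDensity a b μ f φ) {y : ℝ} (hay : a ≤ y) (hyb : y ≤ b) :
    ∫ t in Icc a y, φ t ∂μ = rLim b f y - f a := by
  rw [← Icc_union_Ioc_eq_Icc le_rfl hay, Icc_self,
    setIntegral_union (by simp) measurableSet_Ioc h.int.integrableOn h.int.integrableOn,
    h.sing, h.ioc a y le_rfl hay hyb]
  ring

/-- The integral over `[a, x)` recovers a left-continuous function. -/
theorem ico (h : HasLSDensity a b μ f φ)
    (hf : ∀ x ∈ Ioc a b, ContinuousWithinAt f (Iio x) x) {x : ℝ} (hx : x ∈ Icc a b) :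
    ∫ t in Ico a x, φ t ∂μ = f x - f a := by
  rcases hx.1.eq_or_lt with rfl | hax
  · simp
  have h1 : Tendsto (fun y => ∫ t in Icc a y, φ t ∂μ) (𝓝[<] x) (𝓝 (∫ t in Ico a x, φ t ∂μ)) := by
    refine tendsto_setIntegral_of_eventually_mem_iff h.int (fun _ => measurableSet_Icc)
      measurableSet_Ico fun t => ?_
    rcases lt_or_ge t x with ht | ht
    · filter_upwards [Ioo_mem_nhdsLT ht] with y hy
      simp [hy.1.le, ht]
    · filter_upwards [self_mem_nhdsWithin] with y hy
      have : y < t := lt_of_lt_of_le hy ht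
      simp [not_le.2 this, not_lt.2 ht]
  have h2 : Tendsto (fun y => rLim b f y) (𝓝[<] x) (𝓝 (f x)) := by
    have hfx := hf x ⟨hax, hx.2⟩
    refine (closed_nhds_basis (f x)).tendsto_right_iff.2 fun U hU => ?_
    have hev : ∀ᶠ y in 𝓝[<] x, f y ∈ U := hfx hU.1
    obtain ⟨c, hc, hcU⟩ := (mem_nhdsLT_iff_exists_Ioo_subset).1 hev
    filter_upwards [Ioo_mem_nhdsLT hc, Ioo_mem_nhdsLT hax] with y hy hy'
    refine hU.2.mem_of_tendsto (h.bv.tendsto_rLim ⟨hy'.1.le, hy.2.trans_le hx.2⟩) ?_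
    filter_upwards [Ioo_mem_nhdsGT hy.2] with z hz
    exact hcU ⟨hy.1.trans hz.1, hz.2⟩
  refine tendsto_nhds_unique h1 ((h2.sub_const (f a)).congr' ?_)
  filter_upwards [Ioo_mem_nhdsLT hax] with y hy
  exact (h.icc hy.1.le (hy.2.le.trans hx.2)).symm

theorem singleton_eq_zero (h : HasLSDensity a b μ f φ)
    (hf : ∀ x ∈ Ioc a b, ContinuousWithinAt f (Iio x) x) {x : ℝ} (hx : x ∈ Icc a b) :
    ∫ t in {x}, φ t ∂μ = rLim b f x - f x := by
  have h1 := h.icc hx.1 hx.2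
  rw [← Ico_union_Icc_eq_Icc hx.1 le_rfl, Icc_self, setIntegral_union (by simp)
    (measurableSet_singleton x) h.int.integrableOn h.int.integrableOn, h.ico hf hx] at h1
  linarith

theorem measure_singleton_mul_eq_zero (h : HasLSDensity a b μ f φ)
    (hf : ContinuousOn f (Icc a b)) (hμ : μ (Icc a b)ᶜ = 0) (x : ℝ) : μ.real {x} * φ x = 0 := by
  by_cases hx : x ∈ Icc a b
  · have h1 := h.singleton_eq_zero hf.continuousWithinAt_Iio_Ioc hx
    rw [rLim_eq_self hf.continuousWithinAt_Ioi_Ico hx, sub_self, integral_singleton] at h1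
    simpa using h1
  · have : μ {x} = 0 := measure_mono_null (by simpa using hx) hμ
    simp [Measure.real, this]

/-- The measure of a continuous function does not charge countable sets. -/
theorem ae_eq_zero_of_countable [IsFiniteMeasure μ] (h : HasLSDensity a b μ f φ)
    (hf : ContinuousOn f (Icc a b)) (hμ : μ (Icc a b)ᶜ = 0) {C : Set ℝ} (hC : C.Countable) :
    ∀ᵐ x ∂μ, x ∈ C → φ x = 0 := by
  have : {x | ¬(x ∈ C → φ x = 0)} = ⋃ x ∈ C, {y | y = x ∧ φ y ≠ 0} := by
    ext x; simp
  rw [ae_iff, this, measure_biUnion_null_iff hC]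
  intro x _
  rcases mul_eq_zero.1 (h.measure_singleton_mul_eq_zero hf hμ x) with h0 | h0
  · refine measure_mono_null (t := {x}) (fun y hy => hy.1) ?_
    simpa [Measure.real, ENNReal.toReal_eq_zero_iff] using h0
  · have : {y | y = x ∧ φ y ≠ 0} = ∅ := by
      ext y; simp only [mem_ofPred_eq, mem_empty_iff_false, iff_false, not_and, not_not]
      rintro rfl; exact h0
    rw [this]; simp

theorem ae_rLim_mul [IsFiniteMeasure μ] (h : HasLSDensity a b μ f φ)
    (hf : ContinuousOn f (Icc a b)) (hμ : μ (Icc a b)ᶜ = 0)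
    (hg : BoundedVariationOn g (Icc a b)) : ∀ᵐ x ∂μ, rLim b g x * φ x = g x * φ x := by
  have hI : ∀ᵐ x ∂μ, x ∈ Icc a b := by rwa [ae_iff]
  filter_upwards [hI, h.ae_eq_zero_of_countable hf hμ hg.countable_discontinuities] with x hx hx0
  by_cases hc : ContinuousWithinAt g (Icc a b) x
  · congr 1
    rcases hx.2.eq_or_lt with rfl | hlt
    · simp
    · exact rLim_eq_of_tendsto hlt (hc.mono_left (nhdsGT_le_nhdsWithin_Icc ⟨hx.1, hlt⟩))
  · rw [hx0 ⟨hx, hc⟩]; simp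

/-- The product rule `d(fg) = f dg + g df`, for continuous `f`. -/
theorem mul [IsFiniteMeasure μ] (h : HasLSDensity a b μ f φ) (h' : HasLSDensity a b μ g ψ)
    (hab : a ≤ b)     (hf : ContinuousOn f (Icc a b)) (hμ : μ (Icc a b)ᶜ = 0) :
    HasLSDensity a b μ (fun x => f x * g x) (fun x => f x * ψ x + g x * φ x) := by
  have i1 : Integrable (fun x => f x * ψ x) μ := h'.int.bv_mul h.bv hμ
  have i2 : Integrable (fun x => g x * φ x) μ := h.int.bv_mul h'.bv hμ
  have hrf : ∀ x ∈ Icc a b, rLim b f x = f x := fun x hx =>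
    rLim_eq_self hf.continuousWithinAt_Ioi_Ico hx
  have hs : ∀ x ∈ Icc a b, ∫ t in {x}, φ t ∂μ = 0 := fun x hx => by
    rw [h.singleton_eq_zero hf.continuousWithinAt_Iio_Ioc hx, hrf x hx, sub_self]
  refine ⟨h.bv.mul h'.bv, i1.add i2, fun x y hx hxy hy => ?_, ?_⟩
  · have hxI : x ∈ Icc a b := ⟨hx, hxy.trans hy⟩
    have hyI : y ∈ Icc a b := ⟨hx.trans hxy, hy⟩
    rw [rLim_mul h.bv h'.bv hxI, rLim_mul h.bv h'.bv hyI, hrf x hxI, hrf y hyI,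
      integral_add i1.integrableOn i2.integrableOn]
    have hIoo : ∀ t ∈ Ioc x y, ∫ s in Ioo x t, φ s ∂μ = f t - f x := by
      intro t ht
      have htI : t ∈ Icc a b := ⟨hx.trans ht.1.le, ht.2.trans hy⟩
      have h1 := h.ioc x t hx ht.1.le htI.2
      rw [← Ioo_union_Icc_eq_Ioc ht.1 le_rfl, Icc_self, setIntegral_union (by simp)
        (measurableSet_singleton t) h.int.integrableOn h.int.integrableOn, hs t htI, add_zero,
        hrf t htI, hrf x hxI] at h1
      exact h1
    have hIoc : ∀ s ∈ Ioc x y, ∫ t in Ioc s y, ψ t ∂μ = rLim b g y - rLim b g s := fun s hs =>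
      h'.ioc s y (hx.trans hs.1.le) hs.2 hy
    set μ' := μ.restrict (Ioc x y) with hμ'
    have iprod : Integrable (Function.uncurry fun s t => {p : ℝ × ℝ | p.1 < p.2}.indicator
        (fun p => φ p.1 * ψ p.2) (s, t)) (μ'.prod μ') :=
      ((h.int.restrict (s := Ioc x y)).mul_prod (h'.int.restrict (s := Ioc x y))).indicator
        (measurableSet_lt measurable_fst measurable_snd)
    have hsw := integral_integral_swap iprod
    have hL : ∫ s, ∫ t, {p : ℝ × ℝ | p.1 < p.2}.indicator
        (fun p => φ p.1 * ψ p.2) (s, t) ∂μ' ∂μ' =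
        ∫ s in Ioc x y, (rLim b g y * φ s - g s * φ s) ∂μ := by
      refine integral_congr_ae ?_
      filter_upwards [ae_restrict_mem measurableSet_Ioc,
        ae_restrict_of_ae (h.ae_rLim_mul hf hμ h'.bv)] with s hs hr
      have : (fun t => {p : ℝ × ℝ | p.1 < p.2}.indicator (fun p => φ p.1 * ψ p.2) (s, t)) =
          (Ioi s).indicator fun t => φ s * ψ t := by
        ext t; simp [indicator]
      rw [this, integral_indicator measurableSet_Ioi, hμ', Measure.restrict_restrict
        measurableSet_Ioi]
      have : Ioi s ∩ Ioc x y = Ioc s y := by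
        ext t; simp only [mem_inter_iff, mem_Ioi, mem_Ioc]
        exact ⟨fun h => ⟨h.1, h.2.2⟩, fun h => ⟨h.1, hs.1.trans h.1, h.2⟩⟩
      rw [this, integral_const_mul, hIoc s hs, ← hr]
      ring
    have hR : ∫ t, ∫ s, {p : ℝ × ℝ | p.1 < p.2}.indicator
        (fun p => φ p.1 * ψ p.2) (s, t) ∂μ' ∂μ' =
        ∫ t in Ioc x y, (f t * ψ t - f x * ψ t) ∂μ := by
      refine integral_congr_ae ?_
      filter_upwards [ae_restrict_mem measurableSet_Ioc] with t ht
      have : (fun s => {p : ℝ × ℝ | p.1 < p.2}.indicator (fun p => φ p.1 * ψ p.2) (s, t)) =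
          (Iio t).indicator fun s => φ s * ψ t := by
        ext s; simp [indicator]
      rw [this, integral_indicator measurableSet_Iio, hμ', Measure.restrict_restrict
        measurableSet_Iio]
      have : Iio t ∩ Ioc x y = Ioo x t := by
        ext s; simp only [mem_inter_iff, mem_Iio, mem_Ioc, mem_Ioo]
        exact ⟨fun h => ⟨h.2.1, h.1⟩, fun h => ⟨h.2, h.1, h.2.le.trans ht.2⟩⟩
      rw [this, integral_mul_const, hIoo t ht]
      ring
    rw [hL, hR, integral_sub (h.int.const_mul _).integrableOn i2.integrableOn,
      integral_sub i1.integrableOn (h'.int.const_mul _).integrableOn, integral_const_mul,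
      integral_const_mul, h.ioc x y hx hxy hy, h'.ioc x y hx hxy hy, hrf x hxI, hrf y hyI] at hsw
    linarith
  · have haI : a ∈ Icc a b := left_mem_Icc.2 hab
    have h1 := h'.sing
    have h2 := hs a haI
    rw [integral_singleton, smul_eq_mul] at h1 h2
    rw [rLim_mul h.bv h'.bv haI, hrf a haI, integral_singleton, smul_eq_mul]
    linear_combination f a * h1 + g a * h2

end HasLSDensity

theorem BoundedVariationOn.const_Icc (c : ℝ) : BoundedVariationOn (fun _ : ℝ => c) (Icc a b) :=
  MonotoneOn.boundedVariationOn_Icc monotoneOn_const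

theorem rLim_congr {f g : ℝ → ℝ} (hf : BoundedVariationOn f (Icc a b))
    (hfg : EqOn f g (Icc a b)) {x : ℝ} (hx : x ∈ Icc a b) : rLim b g x = rLim b f x := by
  rcases hx.2.eq_or_lt with rfl | h
  · simp [hfg hx]
  · refine rLim_eq_of_tendsto h ((hf.tendsto_rLim ⟨hx.1, h⟩).congr' ?_)
    filter_upwards [Ioo_mem_nhdsGT h] with y hy
    exact hfg ⟨hx.1.trans hy.1.le, hy.2.le⟩

theorem rLim_add {f g : ℝ → ℝ} (hf : BoundedVariationOn f (Icc a b))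
    (hg : BoundedVariationOn g (Icc a b)) {x : ℝ} (hx : x ∈ Icc a b) :
    rLim b (fun t => f t + g t) x = rLim b f x + rLim b g x := by
  rcases hx.2.eq_or_lt with rfl | h
  · simp
  · exact rLim_eq_of_tendsto h ((hf.tendsto_rLim ⟨hx.1, h⟩).add (hg.tendsto_rLim ⟨hx.1, h⟩))

namespace HasLSDensity

variable {f g φ ψ : ℝ → ℝ}

theorem congr (h : HasLSDensity a b μ f φ) (hab : a ≤ b) (hfg : EqOn f g (Icc a b)) :
    HasLSDensity a b μ g φ := by
  have haI := left_mem_Icc.2 hab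
  refine ⟨?_, h.int, fun x y hx hxy hy => ?_, ?_⟩
  · have := h.bv
    rwa [BoundedVariationOn, eVariationOn.congr hfg] at this
  · rw [rLim_congr h.bv hfg ⟨hx, hxy.trans hy⟩, rLim_congr h.bv hfg ⟨hx.trans hxy, hy⟩,
      h.ioc x y hx hxy hy]
  · rw [rLim_congr h.bv hfg haI, ← hfg haI, h.sing]

theorem const (hab : a ≤ b) (c : ℝ) : HasLSDensity a b μ (fun _ => c) (fun _ => 0) := by
  have h : ∀ x ∈ Icc a b, rLim b (fun _ : ℝ => c) x = c := fun x hx =>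
    rLim_eq_self (f := fun _ : ℝ => c) (fun _ _ => continuousWithinAt_const) hx
  refine ⟨.const_Icc c, integrable_zero _ _ _, fun x y hx hxy hy => ?_, ?_⟩
  · simp [h x ⟨hx, hxy.trans hy⟩, h y ⟨hx.trans hxy, hy⟩]
  · simp [h a (left_mem_Icc.2 hab)]

theorem add (h : HasLSDensity a b μ f φ) (h' : HasLSDensity a b μ g ψ) (hab : a ≤ b) :
    HasLSDensity a b μ (fun x => f x + g x) (fun x => φ x + ψ x) := by
  refine ⟨h.bv.add_Icc h'.bv, h.int.add h'.int, fun x y hx hxy hy => ?_, ?_⟩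
  · rw [rLim_add h.bv h'.bv ⟨hx, hxy.trans hy⟩, rLim_add h.bv h'.bv ⟨hx.trans hxy, hy⟩,
      integral_add h.int.integrableOn h'.int.integrableOn, h.ioc x y hx hxy hy,
      h'.ioc x y hx hxy hy]
    ring
  · rw [rLim_add h.bv h'.bv (left_mem_Icc.2 hab),
      integral_add h.int.integrableOn h'.int.integrableOn, h.sing, h'.sing]
    ring

theorem const_mul [IsFiniteMeasure μ] (h : HasLSDensity a b μ f φ) (hab : a ≤ b)
    (hμ : μ (Icc a b)ᶜ = 0) (c : ℝ) :
    HasLSDensity a b μ (fun x => c * f x) (fun x => c * φ x) := by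
  simpa using (const hab c).mul h hab continuousOn_const hμ

theorem ae_unique (h : HasLSDensity a b μ f φ) (h' : HasLSDensity a b μ g ψ) (hab : a ≤ b)
    (hfg : EqOn f g (Icc a b)) (hμ : μ (Icc a b)ᶜ = 0) : φ =ᵐ[μ] ψ :=
  h.int.ae_eq_of_withDensityᵥ_eq h'.int
    (((h.congr hab hfg).isLS hμ).unique hab (h'.isLS hμ))

/-- A function with zero density is constant with respect to measures without atoms. -/
theorem ae_mul_eq_of_ae_zero [IsFiniteMeasure μ] (h : HasLSDensity a b μ f φ)
    (hφ : φ =ᵐ[μ] 0) (h' : HasLSDensity a b μ g ψ) (hg : ContinuousOn g (Icc a b))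
    (hμ : μ (Icc a b)ᶜ = 0) : ∀ᵐ x ∂μ, f x * ψ x = f b * ψ x := by
  have hI : ∀ᵐ x ∂μ, x ∈ Icc a b := by rwa [ae_iff]
  filter_upwards [hI, h'.ae_rLim_mul hg hμ h.bv] with x hx hr
  have h1 := h.ioc x b hx.1 hx.2 le_rfl
  rw [integral_congr_ae (ae_restrict_of_ae hφ), rLim_right] at h1
  simp only [Pi.zero_apply, integral_zero] at h1
  rw [← hr, show rLim b f x = f b by linarith]

theorem ae_nonpos_of_antitoneOn (h : HasLSDensity a b μ f φ) (hab : a ≤ b)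
    (hf : ContinuousOn f (Icc a b)) (hanti : AntitoneOn f (Icc a b)) (hμ : μ (Icc a b)ᶜ = 0) :
    ∀ᵐ x ∂μ, φ x ≤ 0 := by
  have hcl : ∀ x, max a (min b x) ∈ Icc a b := fun x =>
    ⟨le_max_left _ _, max_le hab (min_le_left _ _)⟩
  have hcont : Continuous fun x => -f (max a (min b x)) :=
    (hf.comp_continuous (by fun_prop) hcl).neg
  have hF : ∀ x ∈ Icc a b, f (max a (min b x)) = f x := fun x hx => by
    simp [min_eq_right hx.2, max_eq_right hx.1]
  let F : StieltjesFunction ℝ :=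
    { toFun := fun x => -f (max a (min b x))
      mono' := fun x y hxy => neg_le_neg (hanti (hcl x) (hcl y)
        (max_le_max le_rfl (min_le_min le_rfl hxy)))
      right_continuous' := fun x => hcont.continuousWithinAt }
  obtain ⟨C, hC⟩ := hanti.boundedVariationOn_Icc.exists_abs_le_Icc
  have : IsFiniteMeasure F.measure := F.isFiniteMeasure_of_forall_abs_le (C := C) fun x => by
    simpa [F] using hC _ (hcl x)
  have hr : ∀ x ∈ Icc a b, rLim b f x = f x := fun x hx =>
    rLim_eq_self hf.continuousWithinAt_Ioi_Ico hx
  have hLS : IsLS a b f (-(F.measure.restrict (Icc a b)).toSignedMeasure) := by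
    refine ⟨fun s hs hsI => ?_, fun x y hx hxy hy => ?_, ?_⟩
    · simp [Measure.toSignedMeasure_apply_measurable hs, measureReal_restrict_apply hs, hsI]
    · have hx' : x ∈ Icc a b := ⟨hx, hxy.trans hy⟩
      have hy' : y ∈ Icc a b := ⟨hx.trans hxy, hy⟩
      rw [_root_.neg_apply, Measure.toSignedMeasure_apply_measurable measurableSet_Ioc,
        measureReal_restrict_apply measurableSet_Ioc,
        inter_eq_left.2 (show Ioc x y ⊆ Icc a b from
          fun t ht => ⟨hx.trans ht.1.le, ht.2.trans hy⟩), Measure.real,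
        StieltjesFunction.measure_Ioc, ENNReal.toReal_ofReal (sub_nonneg.2 (F.mono hxy)),
        hr x hx', hr y hy']
      simp [F, hF x hx', hF y hy']
      ring
    · have haI := left_mem_Icc.2 hab
      have hl : Function.leftLim F a = F a :=
        leftLim_eq_of_tendsto hcont.continuousWithinAt
      rw [_root_.neg_apply,
        Measure.toSignedMeasure_apply_measurable (measurableSet_singleton a),
        measureReal_restrict_apply (measurableSet_singleton a),
        inter_eq_left.2 (by simpa using hab), Measure.real,
        StieltjesFunction.measure_singleton, hl, hr a haI]
      simp
  have heq := (h.isLS hμ).unique hab hLS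
  have h0 : 0 ≤ᵐ[μ] fun x => -φ x := by
    refine ae_nonneg_of_forall_setIntegral_nonneg h.int.neg fun s hs _ => ?_
    have h1 := congrArg (fun ν : SignedMeasure ℝ => ν s) heq
    simp only [withDensityᵥ_apply h.int hs, _root_.neg_apply,
      Measure.toSignedMeasure_apply_measurable hs] at h1
    rw [integral_neg, h1, neg_neg]
    exact measureReal_nonneg
  filter_upwards [h0] with x hx
  simpa using hx

end HasLSDensity

theorem boundedVariationOn_setIntegral {φ : ℝ → ℝ} (hφ : Integrable φ μ) {S : ℝ → Set ℝ}
    (hmono : Monotone S ∨ Antitone S) :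
    BoundedVariationOn (fun x => ∫ t in S x, φ t ∂μ) (Icc a b) := by
  have key : ∀ ψ : ℝ → ℝ, Integrable ψ μ → (∀ x, 0 ≤ ψ x) →
      BoundedVariationOn (fun x => ∫ t in S x, ψ t ∂μ) (Icc a b) := by
    intro ψ hψ h0
    rcases hmono with h | h
    · exact MonotoneOn.boundedVariationOn_Icc fun x _ y _ hxy =>
        setIntegral_mono_set hψ.integrableOn (Eventually.of_forall h0) (h hxy).eventuallyLE
    · exact AntitoneOn.boundedVariationOn_Icc fun x _ y _ hxy =>
        setIntegral_mono_set hψ.integrableOn (Eventually.of_forall h0) (h hxy).eventuallyLE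
  have h1 := (key _ hφ.pos_part fun x => le_max_right _ _).add_Icc
    (key _ hφ.neg_part fun x => le_max_right _ _).neg_Icc
  convert h1 using 2 with x
  rw [← sub_eq_add_neg, ← integral_sub hφ.pos_part.integrableOn hφ.neg_part.integrableOn]
  congr 1; ext t
  rcases le_total 0 (φ t) with h | h <;> simp [h]

theorem continuousWithinAt_setIntegral_Ico {φ : ℝ → ℝ} (hφ : Integrable φ μ) (x : ℝ) :
    ContinuousWithinAt (fun x => ∫ t in Ico a x, φ t ∂μ) (Iio x) x := by
  refine tendsto_setIntegral_of_eventually_mem_iff hφ (fun _ => measurableSet_Ico)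
      measurableSet_Ico fun t => ?_
  rcases lt_or_ge t x with ht | ht
  · filter_upwards [Ioo_mem_nhdsLT ht] with y hy
    simp [hy.1, ht]
  · filter_upwards [self_mem_nhdsWithin] with y hy
    have : y < t := lt_of_lt_of_le hy ht
    simp [not_lt.2 this.le, not_lt.2 ht]

theorem continuousWithinAt_setIntegral_Ioc {φ : ℝ → ℝ} (hφ : Integrable φ μ) (x : ℝ) :
    ContinuousWithinAt (fun x => ∫ t in Ioc x b, φ t ∂μ) (Ioi x) x := by
  refine tendsto_setIntegral_of_eventually_mem_iff hφ (fun _ => measurableSet_Ioc)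
      measurableSet_Ioc fun t => ?_
  rcases lt_or_ge x t with ht | ht
  · filter_upwards [Ioo_mem_nhdsGT ht] with y hy
    simp [hy.2, ht]
  · filter_upwards [self_mem_nhdsWithin] with y hy
    have : t < y := lt_of_le_of_lt ht hy
    simp [not_lt.2 this.le, not_lt.2 ht]

theorem hasLSDensity_setIntegral_Ico {φ : ℝ → ℝ} (hab : a ≤ b) (hφ : Integrable φ μ)
    (hb : ∫ t in {b}, φ t ∂μ = 0) :
    HasLSDensity a b μ (fun x => ∫ t in Ico a x, φ t ∂μ) φ := by
  have hr : ∀ x ∈ Icc a b, rLim b (fun x => ∫ t in Ico a x, φ t ∂μ) x =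
      ∫ t in Icc a x, φ t ∂μ := by
    intro x hx
    rcases hx.2.eq_or_lt with rfl | h
    · rw [rLim_right, ← Ico_union_Icc_eq_Icc hx.1 le_rfl, Icc_self, setIntegral_union (by simp)
        (measurableSet_singleton x) hφ.integrableOn hφ.integrableOn, hb, add_zero]
    · refine rLim_eq_of_tendsto h (tendsto_setIntegral_of_eventually_mem_iff hφ
        (fun _ => measurableSet_Ico) measurableSet_Icc fun t => ?_)
      rcases lt_or_ge x t with ht | ht
      · filter_upwards [Ioo_mem_nhdsGT ht] with y hy
        simp [not_lt.2 hy.2.le, not_le.2 ht]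
      · filter_upwards [self_mem_nhdsWithin] with y hy
        have : t < y := lt_of_le_of_lt ht hy
        simp [this, ht]
  refine ⟨boundedVariationOn_setIntegral hφ
    (Or.inl fun x y hxy => Ico_subset_Ico_right hxy), hφ, fun x y hx hxy hy => ?_, ?_⟩
  · rw [hr x ⟨hx, hxy.trans hy⟩, hr y ⟨hx.trans hxy, hy⟩, ← Icc_union_Ioc_eq_Icc hx hxy,
      setIntegral_union _ measurableSet_Ioc hφ.integrableOn hφ.integrableOn]
    · ring
    · exact disjoint_left.2 fun t h1 h2 => not_lt.2 h1.2 h2.1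
  · rw [hr a (left_mem_Icc.2 hab)]
    simp

theorem hasLSDensity_neg_setIntegral_Ioc {φ : ℝ → ℝ} (hab : a ≤ b) (hφ : Integrable φ μ)
    (ha : ∫ t in {a}, φ t ∂μ = 0) :
    HasLSDensity a b μ (fun x => -∫ t in Ioc x b, φ t ∂μ) φ := by
  have hr : ∀ x ∈ Icc a b, rLim b (fun x => -∫ t in Ioc x b, φ t ∂μ) x =
      -∫ t in Ioc x b, φ t ∂μ := fun x hx =>
    rLim_eq_self (f := fun x => -∫ t in Ioc x b, φ t ∂μ)
      (fun y _ => (continuousWithinAt_setIntegral_Ioc hφ y).neg) hx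
  refine ⟨(boundedVariationOn_setIntegral hφ
    (Or.inr fun x y hxy => Ioc_subset_Ioc_left hxy)).neg_Icc, hφ, fun x y hx hxy hy => ?_, ?_⟩
  · rw [hr x ⟨hx, hxy.trans hy⟩, hr y ⟨hx.trans hxy, hy⟩, ← Ioc_union_Ioc_eq_Ioc hxy hy,
      setIntegral_union _ measurableSet_Ioc hφ.integrableOn hφ.integrableOn]
    · ring
    · exact disjoint_left.2 fun t h1 h2 => not_lt.2 h1.2 h2.1
  · rw [hr a (left_mem_Icc.2 hab), ha, sub_self]

/-- `ν` has the measurable density `φ` with respect to `μ`. -/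
structure HasSignedDensity (μ : Measure ℝ) (ν : SignedMeasure ℝ) (φ : ℝ → ℝ) : Prop where
  meas : Measurable φ
  int : Integrable φ μ
  eq : ν = μ.withDensityᵥ φ

namespace HasSignedDensity

variable {ν : SignedMeasure ℝ} {f g φ : ℝ → ℝ}

theorem apply (h : HasSignedDensity μ ν φ) {s : Set ℝ} (hs : MeasurableSet s) :
    ν s = ∫ x in s, φ x ∂μ := by
  rw [h.eq, withDensityᵥ_apply h.int hs]

theorem sInt (h : HasSignedDensity μ ν φ) (hμ : μ (Icc a b)ᶜ = 0)
    (hg : BoundedVariationOn g (Icc a b)) {s : Set ℝ} (hs : MeasurableSet s) :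
    sInt ν g s = ∫ x in s, g x * φ x ∂μ := by
  rw [h.eq, sInt_withDensity h.meas h.int (h.int.bv_mul hg hμ) hs]

theorem hasLSDensity (h : HasSignedDensity μ ν φ) (hf : BoundedVariationOn f (Icc a b))
    (hν : IsLS a b f ν) : HasLSDensity a b μ f φ :=
  .of_isLS hf h.int (h.eq ▸ hν)

end HasSignedDensity

theorem exists_common_density {ι : Type*} [Fintype ι] (ν : ι → SignedMeasure ℝ)
    (hν : ∀ i s, MeasurableSet s → s ∩ Icc a b = ∅ → ν i s = 0) :
    ∃ μ : Measure ℝ, IsFiniteMeasure μ ∧ μ (Icc a b)ᶜ = 0 ∧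
      ∀ i, ∃ φ, HasSignedDensity μ (ν i) φ := by
  have hfin : ∀ i, IsFiniteMeasure (ν i).totalVariation := fun i => by
    unfold SignedMeasure.totalVariation; infer_instance
  set m : Measure ℝ := ∑ i, (ν i).totalVariation with hm
  have hmfin : IsFiniteMeasure m := ⟨by
    rw [hm, Measure.finsetSum_apply]
    exact ENNReal.sum_lt_top.2 fun i _ => measure_lt_top _ _⟩
  refine ⟨m.restrict (Icc a b), inferInstance, by simp [Measure.restrict_apply
    measurableSet_Icc.compl], fun i => ⟨(ν i).rnDeriv _, SignedMeasure.measurable_rnDeriv _ _,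
    SignedMeasure.integrable_rnDeriv _ _, (SignedMeasure.withDensityᵥ_rnDeriv_eq _ _ ?_).symm⟩⟩
  refine VectorMeasure.AbsolutelyContinuous.mk fun s hs h0 => ?_
  rw [Measure.toENNRealVectorMeasure_apply_measurable hs, Measure.restrict_apply hs, hm,
    Measure.finsetSum_apply, Finset.sum_eq_zero_iff] at h0
  rw [SignedMeasure.apply_inter_of_null_compl measurableSet_Icc (hν i) hs]
  exact (ν i).null_of_totalVariation_zero (h0 i (Finset.mem_univ i))

/-- The density of `((κ + h) / l) dI + (1 / l) dD`, where `dI` and `dD` have densities `I`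
and `D`. -/
def weightDensity (κ : ℝ) (l h I D : ℝ → ℝ) (x : ℝ) : ℝ :=
  (κ + h x) / l x * I x + (l x)⁻¹ * D x

section WeightDensity

variable {κ : ℝ} {l h I D : ℝ → ℝ}

theorem BoundedVariationOn.add_div_Icc (κ : ℝ) (hh : BoundedVariationOn h (Icc a b))
    (hl : BoundedVariationOn (fun x => (l x)⁻¹) (Icc a b)) :
    BoundedVariationOn (fun x => (κ + h x) / l x) (Icc a b) := by
  simp only [div_eq_mul_inv]
  exact ((BoundedVariationOn.const_Icc κ).add_Icc hh).mul hl

theorem integrable_weightDensity (hl : BoundedVariationOn (fun x => (l x)⁻¹) (Icc a b))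
    (hh : BoundedVariationOn h (Icc a b)) (hI : Integrable I μ) (hD : Integrable D μ)
    (hμ : μ (Icc a b)ᶜ = 0) : Integrable (weightDensity κ l h I D) μ :=
  (hI.bv_mul (hh.add_div_Icc κ hl) hμ).add (hD.bv_mul hl hμ)

theorem setIntegral_weightDensity (hl : BoundedVariationOn (fun x => (l x)⁻¹) (Icc a b))
    (hh : BoundedVariationOn h (Icc a b)) (hI : Integrable I μ) (hD : Integrable D μ)
    (hμ : μ (Icc a b)ᶜ = 0) (s : Set ℝ) :
    ∫ x in s, weightDensity κ l h I D x ∂μ = κ * (∫ x in s, (l x)⁻¹ * I x ∂μ) +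
      ((∫ x in s, h x / l x * I x ∂μ) + ∫ x in s, (l x)⁻¹ * D x ∂μ) := by
  have h1 := (hI.bv_mul hl hμ).integrableOn (s := s)
  have h2 : IntegrableOn (fun x => h x / l x * I x) s μ := by
    refine (hI.bv_mul ?_ hμ).integrableOn
    simp only [div_eq_mul_inv]
    exact hh.mul hl
  have h3 := (hD.bv_mul hl hμ).integrableOn (s := s)
  have h4 : IntegrableOn (fun x => h x / l x * I x + (l x)⁻¹ * D x) s μ := h2.add h3
  rw [← integral_const_mul, ← integral_add h2 h3, ← integral_add (h1.const_mul κ) h4]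
  congr 1; ext x
  simp only [weightDensity]
  ring

theorem sInt_add_sInt_eq_setIntegral_weightDensity {νI νD : SignedMeasure ℝ}
    (hl : BoundedVariationOn (fun x => (l x)⁻¹) (Icc a b))
    (hh : BoundedVariationOn h (Icc a b)) (hI : HasSignedDensity μ νI I)
    (hD : HasSignedDensity μ νD D) (hμ : μ (Icc a b)ᶜ = 0) {s : Set ℝ} (hs : MeasurableSet s) :
    sInt νI (fun x => (κ + h x) / l x) s + sInt νD (fun x => (l x)⁻¹) s =
      ∫ x in s, weightDensity κ l h I D x ∂μ := by
  have h1 := hh.add_div_Icc κ hl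
  rw [hI.sInt hμ h1 hs, hD.sInt hμ hl hs, ← integral_add
    (hI.int.bv_mul h1 hμ).integrableOn (hD.int.bv_mul hl hμ).integrableOn]
  rfl

end WeightDensity

/-- The pointwise form of the equation `w' dp + d(p w) = −dg`, solved for the density `W`
of `w`. -/
theorem add_mul_eq_neg_iff {m p w w' hm hp κ L I H D G W : ℝ} (hm0 : m ≠ 0) (hp0 : p ≠ 0)
    (hI : p * I + p⁻¹ * L = 0) (hD : D = p⁻¹ * H + hm * I) (hH : H = -(m * G))
    (hκ : (m * p * (w + w') - hm - hp) * L = κ * L) :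
    w' * L + (p * W + w * L) = -G ↔ W = (κ + hp) / m * I + m⁻¹ * D := by
  have hI' : I = -(p⁻¹ * p⁻¹ * L) := by
    field_simp at hI ⊢
    linear_combination hI
  have key : (κ + hp) / m * I + m⁻¹ * D = -p⁻¹ * ((w + w') * L + G) := by
    rw [hD, hH, hI']
    field_simp
    linear_combination hκ
  rw [key]
  constructor
  · intro h
    field_simp
    linear_combination h
  · rintro rfl
    field_simp
    ring

/-- The densities with respect to `μ` of all measures in the inverse problem. -/
structure InverseDensities (a b : ℝ) (μ : Measure ℝ)
    (lm lp hm hp Lm Lp Im Ip Hm Hp Dm Dp Gm Gp : ℝ → ℝ) : Prop where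
  le : a ≤ b
  null : μ (Icc a b)ᶜ = 0
  lm_cont : ContinuousOn lm (Icc a b)
  lp_cont : ContinuousOn lp (Icc a b)
  lm_pos : ∀ x ∈ Icc a b, 0 < lm x
  lp_pos : ∀ x ∈ Icc a b, 0 < lp x
  hm_left : ∀ x ∈ Ioc a b, ContinuousWithinAt hm (Iio x) x
  hp_right : ∀ x ∈ Ico a b, ContinuousWithinAt hp (Ioi x) x
  dlm : HasLSDensity a b μ lm Lm
  dlp : HasLSDensity a b μ lp Lp
  dim : HasLSDensity a b μ (fun x => (lm x)⁻¹) Im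
  dip : HasLSDensity a b μ (fun x => (lp x)⁻¹) Ip
  dhm : HasLSDensity a b μ hm Hm
  dhp : HasLSDensity a b μ hp Hp
  dhmlp : HasLSDensity a b μ (fun x => hm x / lp x) Dm
  dhplm : HasLSDensity a b μ (fun x => hp x / lm x) Dp
  hm_eq : ∀ᵐ x ∂μ, Hm x = -(lm x * Gm x)
  hp_eq : ∀ᵐ x ∂μ, Hp x = -(lp x * Gp x)

namespace HasLSDensity

variable [IsFiniteMeasure μ] {f h L I H D : ℝ → ℝ}

theorem ae_mul_add_inv_mul_eq_zero (hf : HasLSDensity a b μ f L)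
    (hi : HasLSDensity a b μ (fun x => (f x)⁻¹) I) (hab : a ≤ b) (hc : ContinuousOn f (Icc a b))
    (h0 : ∀ x ∈ Icc a b, 0 < f x) (hμ : μ (Icc a b)ᶜ = 0) :
    ∀ᵐ x ∂μ, f x * I x + (f x)⁻¹ * L x = 0 :=
  (hf.mul hi hab hc hμ).ae_unique (const hab 1) hab
    (fun _ hx => mul_inv_cancel₀ (h0 _ hx).ne') hμ

theorem ae_div_eq (hh : HasLSDensity a b μ h H)
    (hi : HasLSDensity a b μ (fun x => (f x)⁻¹) I)
    (hd : HasLSDensity a b μ (fun x => h x / f x) D) (hab : a ≤ b)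
    (hc : ContinuousOn f (Icc a b)) (h0 : ∀ x ∈ Icc a b, 0 < f x) (hμ : μ (Icc a b)ᶜ = 0) :
    ∀ᵐ x ∂μ, D x = (f x)⁻¹ * H x + h x * I x :=
  hd.ae_unique (hi.mul hh hab (hc.inv₀ fun x hx => (h0 x hx).ne') hμ) hab
    (fun _ _ => div_eq_inv_mul _ _) hμ

end HasLSDensity

namespace InverseDensities

variable {lm lp hm hp Lm Lp Im Ip Hm Hp Dm Dp Gm Gp wm wp Wm Wp : ℝ → ℝ} {κ : ℝ}
  [IsFiniteMeasure μ]

/-- If `λ₋ λ₊ (w₋ + w₊) − h₋ − h₊` equals `κ` almost everywhere with respect to `dλ₋` and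
`dλ₊`, then the inverse equations hold exactly if `dw₋` and `dw₊` have the stated densities. -/
theorem ae_equations_iff
    (D : InverseDensities a b μ lm lp hm hp Lm Lp Im Ip Hm Hp Dm Dp Gm Gp)
    (hLp : ∀ᵐ x ∂μ, (lm x * lp x * (wm x + wp x) - hm x - hp x) * Lp x = κ * Lp x)
    (hLm : ∀ᵐ x ∂μ, (lm x * lp x * (wm x + wp x) - hm x - hp x) * Lm x = κ * Lm x) :
    ∀ᵐ x ∂μ,
      (wp x * Lp x + (lp x * Wm x + wm x * Lp x) = -Gm x ↔ Wm x = weightDensity κ lm hp Ip Dm x) ∧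
      (wm x * Lm x + (lm x * Wp x + wp x * Lm x) = -Gp x ↔
        Wp x = weightDensity κ lp hm Im Dp x) := by
  have hI : ∀ᵐ x ∂μ, x ∈ Icc a b := by
    rw [ae_iff]
    exact D.null
  filter_upwards [hI, hLp, hLm, D.hm_eq, D.hp_eq,
    D.dlm.ae_mul_add_inv_mul_eq_zero D.dim D.le D.lm_cont D.lm_pos D.null,
    D.dlp.ae_mul_add_inv_mul_eq_zero D.dip D.le D.lp_cont D.lp_pos D.null,
    D.dhm.ae_div_eq D.dip D.dhmlp D.le D.lp_cont D.lp_pos D.null,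
    D.dhp.ae_div_eq D.dim D.dhplm D.le D.lm_cont D.lm_pos D.null]
    with x hx hLp hLm hHm hHp hIm hIp hDm hDp
  have hm0 := (D.lm_pos x hx).ne'
  have hp0 := (D.lp_pos x hx).ne'
  exact ⟨add_mul_eq_neg_iff hm0 hp0 hIp hDm hHm hLp,
    add_mul_eq_neg_iff hp0 hm0 hIm hDp hHp (by linear_combination hLm)⟩

/-- Solutions of the inverse equations have the explicit form. -/
theorem eq_of_ae_equations
    (D : InverseDensities a b μ lm lp hm hp Lm Lp Im Ip Hm Hp Dm Dp Gm Gp)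
    (hΓ : (lm b * lp b)⁻¹ - ∫ x in Icc a b, (lm x)⁻¹ * Ip x ∂μ ≠ 0)
    (hκ : ((lm b * lp b)⁻¹ - ∫ x in Icc a b, (lm x)⁻¹ * Ip x ∂μ) * κ =
      (∫ x in Icc a b, hp x / lm x * Ip x ∂μ) + (∫ x in Icc a b, (lm x)⁻¹ * Dm x ∂μ) -
        (hm b + hp b) / (lm b * lp b))
    (hwm : HasLSDensity a b μ wm Wm) (hwp : HasLSDensity a b μ wp Wp)
    (hwmL : ∀ x ∈ Ioc a b, ContinuousWithinAt wm (Iio x) x)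
    (hwpR : ∀ x ∈ Ico a b, ContinuousWithinAt wp (Ioi x) x)
    (hwma : wm a = 0) (hwpb : wp b = 0)
    (hi : ∀ᵐ x ∂μ, wp x * Lp x + (lp x * Wm x + wm x * Lp x) = -Gm x)
    (hii : ∀ᵐ x ∂μ, wm x * Lm x + (lm x * Wp x + wp x * Lm x) = -Gp x) :
    ∀ x ∈ Icc a b, wm x = ∫ t in Ico a x, weightDensity κ lm hp Ip Dm t ∂μ ∧
      wp x = -∫ t in Ioc x b, weightDensity κ lp hm Im Dp t ∂μ := by
  have hb := right_mem_Icc.2 D.le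
  have hR := ((D.dlm.mul D.dlp D.le D.lm_cont D.null).mul (hwm.add hwp D.le) D.le
    (D.lm_cont.mul D.lp_cont) D.null).add ((D.dhm.add D.dhp D.le).const_mul D.le D.null (-1)) D.le
  have hR0 : (fun x => lm x * lp x * (Wm x + Wp x) +
      (wm x + wp x) * (lm x * Lp x + lp x * Lm x) + -1 * (Hm x + Hp x)) =ᵐ[μ] 0 := by
    filter_upwards [hi, hii, D.hm_eq, D.hp_eq] with x hi hii hHm hHp
    simp only [Pi.zero_apply]
    linear_combination lm x * hi + lp x * hii - hHm - hHp
  obtain ⟨κ', hκ'⟩ : ∃ κ', κ' = lm b * lp b * wm b - hm b - hp b := ⟨_, rfl⟩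
  have hdens : ∀ᵐ x ∂μ, Wm x = weightDensity κ' lm hp Ip Dm x ∧
      Wp x = weightDensity κ' lp hm Im Dp x := by
    have hLp : ∀ᵐ x ∂μ, (lm x * lp x * (wm x + wp x) - hm x - hp x) * Lp x = κ' * Lp x := by
      filter_upwards [hR.ae_mul_eq_of_ae_zero hR0 D.dlp D.lp_cont D.null] with x hx
      rw [hκ']
      linear_combination hx + lm b * lp b * hwpb * Lp x
    have hLm : ∀ᵐ x ∂μ, (lm x * lp x * (wm x + wp x) - hm x - hp x) * Lm x = κ' * Lm x := by
      filter_upwards [hR.ae_mul_eq_of_ae_zero hR0 D.dlm D.lm_cont D.null] with x hx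
      rw [hκ']
      linear_combination hx + lm b * lp b * hwpb * Lm x
    filter_upwards [hi, hii, D.ae_equations_iff (Wm := Wm) (Wp := Wp) hLp hLm] with x hi hii h
    exact ⟨h.1.1 hi, h.2.1 hii⟩
  have hWm : Wm =ᵐ[μ] weightDensity κ' lm hp Ip Dm := hdens.mono fun x hx => hx.1
  have hWp : Wp =ᵐ[μ] weightDensity κ' lp hm Im Dp := hdens.mono fun x hx => hx.2
  have hwb := hwm.icc D.le le_rfl
  rw [integral_congr_ae (ae_restrict_of_ae hWm), setIntegral_weightDensity D.dim.bv D.dhp.bv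
    D.dip.int D.dhmlp.int D.null, rLim_right, hwma, sub_zero] at hwb
  have hq : lm b * lp b ≠ 0 := (mul_pos (D.lm_pos b hb) (D.lp_pos b hb)).ne'
  obtain rfl : κ' = κ := by
    refine mul_left_cancel₀ hΓ (Eq.trans ?_ hκ.symm)
    have h1 : (lm b * lp b)⁻¹ * κ' = wm b - (hm b + hp b) / (lm b * lp b) := by
      rw [hκ']
      have := D.lm_pos b hb
      have := D.lp_pos b hb
      field_simp
      ring
    linear_combination h1 - hwb
  intro x hx
  rw [← integral_congr_ae (ae_restrict_of_ae hWm), ← integral_congr_ae (ae_restrict_of_ae hWp),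
    hwm.ico hwmL hx, hwp.ioc x b hx.1 hx.2 le_rfl, rLim_right, rLim_eq_self hwpR hx, hwma, hwpb]
  constructor <;> ring

/-- The explicit pair of weights solves the inverse equations. -/
theorem hasLSDensity_and_ae_equations
    (D : InverseDensities a b μ lm lp hm hp Lm Lp Im Ip Hm Hp Dm Dp Gm Gp)
    (hκ : ((lm b * lp b)⁻¹ - ∫ x in Icc a b, (lm x)⁻¹ * Ip x ∂μ) * κ =
      (∫ x in Icc a b, hp x / lm x * Ip x ∂μ) + (∫ x in Icc a b, (lm x)⁻¹ * Dm x ∂μ) -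
        (hm b + hp b) / (lm b * lp b))
    (hwm : wm = fun x => ∫ t in Ico a x, weightDensity κ lm hp Ip Dm t ∂μ)
    (hwp : wp = fun x => -∫ t in Ioc x b, weightDensity κ lp hm Im Dp t ∂μ) :
    HasLSDensity a b μ wm (weightDensity κ lm hp Ip Dm) ∧
      HasLSDensity a b μ wp (weightDensity κ lp hm Im Dp) ∧
      ∀ᵐ x ∂μ, wp x * Lp x + (lp x * weightDensity κ lm hp Ip Dm x + wm x * Lp x) = -Gm x ∧
        wm x * Lm x + (lm x * weightDensity κ lp hm Im Dp x + wp x * Lm x) = -Gp x := by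
  have ha := left_mem_Icc.2 D.le
  have hb := right_mem_Icc.2 D.le
  have hlm0 : ∀ x ∈ Icc a b, lm x ≠ 0 := fun x hx => (D.lm_pos x hx).ne'
  have hlp0 : ∀ x ∈ Icc a b, lp x ≠ 0 := fun x hx => (D.lp_pos x hx).ne'
  have him := D.lm_cont.inv₀ hlm0
  have hip := D.lp_cont.inv₀ hlp0
  have hF := integrable_weightDensity (κ := κ) D.dim.bv D.dhp.bv D.dip.int D.dhmlp.int D.null
  have hH := integrable_weightDensity (κ := κ) D.dip.bv D.dhm.bv D.dim.int D.dhplm.int D.null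
  have hFb : ∫ t in {b}, weightDensity κ lm hp Ip Dm t ∂μ = 0 := by
    have h1 := D.dhmlp.singleton_eq_zero (fun x hx => (D.hm_left x hx).div
      (D.lp_cont.continuousWithinAt_Iio_Ioc x hx) (hlp0 x (Ioc_subset_Icc_self hx))) hb
    rw [rLim_right, sub_self, integral_singleton, smul_eq_mul] at h1
    rw [integral_singleton, smul_eq_mul, weightDensity]
    linear_combination (lm b)⁻¹ * h1 +
      (κ + hp b) / lm b * D.dip.measure_singleton_mul_eq_zero hip D.null b
  have hHa : ∫ t in {a}, weightDensity κ lp hm Im Dp t ∂μ = 0 := by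
    have h1 := D.dhplm.sing
    rw [rLim_eq_self (f := fun x => hp x / lm x) (fun x hx => (D.hp_right x hx).div
      (D.lm_cont.continuousWithinAt_Ioi_Ico x hx) (hlm0 x (Ico_subset_Icc_self hx))) ha,
      sub_self, integral_singleton, smul_eq_mul] at h1
    rw [integral_singleton, smul_eq_mul, weightDensity]
    linear_combination (lp a)⁻¹ * h1 +
      (κ + hm a) / lp a * D.dim.measure_singleton_mul_eq_zero him D.null a
  have hdm : HasLSDensity a b μ wm _ := hwm ▸ hasLSDensity_setIntegral_Ico D.le hF hFb
  have hdp : HasLSDensity a b μ wp _ := hwp ▸ hasLSDensity_neg_setIntegral_Ioc D.le hH hHa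
  refine ⟨hdm, hdp, ?_⟩
  have hR := (hdm.add hdp D.le).add ((((D.dim.mul D.dip D.le him D.null).const_mul D.le D.null
    κ).add ((D.dim.mul D.dhmlp D.le him D.null).add (D.dip.mul D.dhplm D.le hip D.null) D.le)
    D.le).const_mul D.le D.null (-1)) D.le
  have hR0 : ∀ x, weightDensity κ lm hp Ip Dm x + weightDensity κ lp hm Im Dp x +
      -1 * (κ * ((lm x)⁻¹ * Ip x + (lp x)⁻¹ * Im x) + ((lm x)⁻¹ * Dm x + hm x / lp x * Im x +
        ((lp x)⁻¹ * Dp x + hp x / lm x * Ip x))) = 0 := fun x => by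
    simp only [weightDensity]
    ring
  have hwb : wm b = κ * (∫ x in Icc a b, (lm x)⁻¹ * Ip x ∂μ) +
      ((∫ x in Icc a b, hp x / lm x * Ip x ∂μ) + ∫ x in Icc a b, (lm x)⁻¹ * Dm x ∂μ) := by
    rw [← setIntegral_weightDensity D.dim.bv D.dhp.bv D.dip.int D.dhmlp.int D.null,
      hdm.icc D.le le_rfl, rLim_right, hwm]
    simp
  have hwpb : wp b = 0 := by simp [hwp]
  have hRb : wm b + wp b + -1 * (κ * ((lm b)⁻¹ * (lp b)⁻¹) + ((lm b)⁻¹ * (hm b / lp b) +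
      (lp b)⁻¹ * (hp b / lm b))) = 0 := by
    rw [mul_inv] at hκ
    rw [hwpb, hwb]
    rw [div_eq_mul_inv (hm b + hp b), mul_inv] at hκ
    rw [div_eq_mul_inv (hm b), div_eq_mul_inv (hp b)]
    linear_combination -hκ
  have hrel : ∀ ψ : ℝ → ℝ, (∀ᵐ x ∂μ, (wm x + wp x + -1 * (κ * ((lm x)⁻¹ * (lp x)⁻¹) +
      ((lm x)⁻¹ * (hm x / lp x) + (lp x)⁻¹ * (hp x / lm x)))) * ψ x = (wm b + wp b + -1 *
      (κ * ((lm b)⁻¹ * (lp b)⁻¹) + ((lm b)⁻¹ * (hm b / lp b) + (lp b)⁻¹ * (hp b / lm b)))) * ψ x) →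
      ∀ᵐ x ∂μ, (lm x * lp x * (wm x + wp x) - hm x - hp x) * ψ x = κ * ψ x := by
    intro ψ hψ
    have hI : ∀ᵐ x ∂μ, x ∈ Icc a b := by
      rw [ae_iff]
      exact D.null
    filter_upwards [hI, hψ] with x hx h
    have hm0 := hlm0 x hx
    have hp0 := hlp0 x hx
    rw [hRb, zero_mul] at h
    field_simp at h
    linear_combination h
  filter_upwards [D.ae_equations_iff (Wm := weightDensity κ lm hp Ip Dm)
    (Wp := weightDensity κ lp hm Im Dp)
    (hrel Lp (hR.ae_mul_eq_of_ae_zero (Eventually.of_forall hR0) D.dlp D.lp_cont D.null))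
    (hrel Lm (hR.ae_mul_eq_of_ae_zero (Eventually.of_forall hR0) D.dlm D.lm_cont D.null))]
    with x hx
  exact ⟨hx.1.2 rfl, hx.2.2 rfl⟩

end InverseDensities

/-- An equation between signed measures holds exactly if it holds for their densities. -/
theorem forall_setIntegral_add_eq_neg_iff {φ ψ γ : ℝ → ℝ} (hφ : Integrable φ μ)
    (hψ : Integrable ψ μ) (hγ : Integrable γ μ) :
    (∀ s, MeasurableSet s → (∫ x in s, φ x ∂μ) + ∫ x in s, ψ x ∂μ = -∫ x in s, γ x ∂μ) ↔
      ∀ᵐ x ∂μ, φ x + ψ x = -γ x := by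
  have hadd : ∀ s, (∫ x in s, φ x ∂μ) + ∫ x in s, ψ x ∂μ = ∫ x in s, (φ x + ψ x) ∂μ := fun s =>
    (integral_add hφ.integrableOn hψ.integrableOn).symm
  simp only [hadd, ← integral_neg]
  refine ⟨fun h => ?_, fun h s _ => integral_congr_ae (ae_restrict_of_ae h)⟩
  exact (hφ.add hψ).ae_eq_of_forall_setIntegral_eq _ _ hγ.neg fun s hs _ => h s hs

theorem InverseDensities.invEq_iff [IsFiniteMeasure μ]
    {lm lp hm hp Lm Lp Im Ip Hm Hp Dm Dp Gm Gp wm wp Wm Wp : ℝ → ℝ}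
    {νlm νlp νgm νgp : SignedMeasure ℝ}
    (D : InverseDensities a b μ lm lp hm hp Lm Lp Im Ip Hm Hp Dm Dp Gm Gp)
    (hνlm : HasSignedDensity μ νlm Lm) (hνlp : HasSignedDensity μ νlp Lp)
    (hνgm : HasSignedDensity μ νgm Gm) (hνgp : HasSignedDensity μ νgp Gp)
    (hwm : HasLSDensity a b μ wm Wm) (hwp : HasLSDensity a b μ wp Wp) (hw : WPair a b wm wp) :
    InvEq a b lm lp νlm νlp νgm νgp wm wp ↔
      (∀ᵐ x ∂μ, wp x * Lp x + (lp x * Wm x + wm x * Lp x) = -Gm x) ∧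
      ∀ᵐ x ∂μ, wm x * Lm x + (lm x * Wp x + wp x * Lm x) = -Gp x := by
  have hpw := D.dlp.mul hwm D.le D.lp_cont D.null
  have hmw := D.dlm.mul hwp D.le D.lm_cont D.null
  rw [← forall_setIntegral_add_eq_neg_iff (D.dlp.int.bv_mul hwp.bv D.null) hpw.int hνgm.int,
    ← forall_setIntegral_add_eq_neg_iff (D.dlm.int.bv_mul hwm.bv D.null) hmw.int hνgp.int]
  constructor
  · rintro ⟨-, h⟩
    have h := h _ _ (hpw.isLS D.null) (hmw.isLS D.null)
    constructor <;> intro s hs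
    · have := (h s hs).1
      rwa [hνlp.sInt D.null hwp.bv hs, withDensityᵥ_apply hpw.int hs, hνgm.apply hs] at this
    · have := (h s hs).2
      rwa [hνlm.sInt D.null hwm.bv hs, withDensityᵥ_apply hmw.int hs, hνgp.apply hs] at this
  · rintro ⟨h1, h2⟩
    refine ⟨hw, fun ν ν' hν hν' s hs => ?_⟩
    rw [hν.unique D.le (hpw.isLS D.null), hν'.unique D.le (hmw.isLS D.null),
      hνlp.sInt D.null hwp.bv hs, withDensityᵥ_apply hpw.int hs, hνgm.apply hs,
      hνlm.sInt D.null hwm.bv hs, withDensityᵥ_apply hmw.int hs, hνgp.apply hs]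
    exact ⟨h1 s hs, h2 s hs⟩

theorem HasSignedDensity.ae_eq_neg_mul {ν ν' : SignedMeasure ℝ} {g φ ψ : ℝ → ℝ}
    (hν : HasSignedDensity μ ν φ) (hν' : HasSignedDensity μ ν' ψ)
    (hg : BoundedVariationOn g (Icc a b)) (hμ : μ (Icc a b)ᶜ = 0)
    (h : ∀ s, MeasurableSet s → ν s = -_root_.sInt ν' g s) : ∀ᵐ x ∂μ, φ x = -(g x * ψ x) := by
  refine hν.int.ae_eq_of_forall_setIntegral_eq _ _ (hν'.int.bv_mul hg hμ).neg fun s hs _ => ?_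
  rw [integral_neg, ← hν'.sInt hμ hg hs, ← h s hs, hν.apply hs]


end LebesgueStieltjes
/-- existence and uniqueness for the inverse problem: under (A3) and
(A6), for given `gm, gp` there is a unique admissible pair `(wm, wp)` solving
`wp dλ₊ + d(λ₊ wm) = −dgm`, `wm dλ₋ + d(λ₋ wp) = −dgp`, `wm a = 0 = wp b`, and it is
given by `wm x = ∫_{[a,x)} { ((κ+hp)/λ₋) d(1/λ₊) + (1/λ₋) d(hm/λ₊) }` and
`wp x = −∫_{(x,b]} { ((κ+hm)/λ₊) d(1/λ₋) + (1/λ₊) d(hp/λ₋) }`, where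
`κ = Γ⁻¹ [ ∫_{Ī} { (hp/λ₋) d(1/λ₊) + (1/λ₋) d(hm/λ₊) } − (hm b + hp b)/(λ₋(b)λ₊(b)) ]`
and `dhm = −λ₋ dgm`, `dhp = −λ₊ dgp`. -/
theorem stmt6 (a b : ℝ) (hab : a < b) (lm lp : ℝ → ℝ)
    (hA3 : A3 a b lm lp) (hA6 : A6 a b lm lp)
    (gm gp hm hp : ℝ → ℝ)
    (hgmB : ∃ C, ∀ x ∈ Set.Icc a b, |gm x| ≤ C)
    (hgpB : ∃ C, ∀ x ∈ Set.Icc a b, |gp x| ≤ C)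
    (hgmBV : BoundedVariationOn gm (Set.Icc a b))
    (hgpBV : BoundedVariationOn gp (Set.Icc a b))
    (hgmL : ∀ x ∈ Set.Ioc a b, ContinuousWithinAt gm (Set.Iio x) x)
    (hgpR : ∀ x ∈ Set.Ico a b, ContinuousWithinAt gp (Set.Ioi x) x)
    (hhmB : ∃ C, ∀ x ∈ Set.Icc a b, |hm x| ≤ C)
    (hhpB : ∃ C, ∀ x ∈ Set.Icc a b, |hp x| ≤ C)
    (hhmBV : BoundedVariationOn hm (Set.Icc a b))
    (hhpBV : BoundedVariationOn hp (Set.Icc a b))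
    (hhmL : ∀ x ∈ Set.Ioc a b, ContinuousWithinAt hm (Set.Iio x) x)
    (hhpR : ∀ x ∈ Set.Ico a b, ContinuousWithinAt hp (Set.Ioi x) x)
    (νgm νgp νhm νhp νlm νlp νip νim νhmlp νhplm : MeasureTheory.SignedMeasure ℝ)
    (hνgm : IsLS a b gm νgm) (hνgp : IsLS a b gp νgp)
    (hνhm : IsLS a b hm νhm) (hνhp : IsLS a b hp νhp)
    (hνlm : IsLS a b lm νlm) (hνlp : IsLS a b lp νlp)
    (hνip : IsLS a b (fun x => (lp x)⁻¹) νip)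
    (hνim : IsLS a b (fun x => (lm x)⁻¹) νim)
    (hνhmlp : IsLS a b (fun x => hm x / lp x) νhmlp)
    (hνhplm : IsLS a b (fun x => hp x / lm x) νhplm)
    (hhm : ∀ s : Set ℝ, MeasurableSet s → νhm s = - sInt νgm lm s)
    (hhp : ∀ s : Set ℝ, MeasurableSet s → νhp s = - sInt νgp lp s) :
    ∃ wm wp : ℝ → ℝ, InvEq a b lm lp νlm νlp νgm νgp wm wp ∧
      (∀ wm' wp' : ℝ → ℝ, InvEq a b lm lp νlm νlp νgm νgp wm' wp' →
        Set.EqOn wm' wm (Set.Icc a b) ∧ Set.EqOn wp' wp (Set.Icc a b)) ∧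
      ∀ x ∈ Set.Icc a b,
        wm x = sInt νip (fun t => ((Gam a b lm lp νip)⁻¹ *
                  (sInt νip (fun r => hp r / lm r) (Set.Icc a b) +
                    sInt νhmlp (fun r => (lm r)⁻¹) (Set.Icc a b) -
                    (hm b + hp b) / (lm b * lp b)) + hp t) / lm t) (Set.Ico a x) +
                sInt νhmlp (fun t => (lm t)⁻¹) (Set.Ico a x) ∧
        wp x = -(sInt νim (fun t => ((Gam a b lm lp νip)⁻¹ *
                  (sInt νip (fun r => hp r / lm r) (Set.Icc a b) +
                    sInt νhmlp (fun r => (lm r)⁻¹) (Set.Icc a b) -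
                    (hm b + hp b) / (lm b * lp b)) + hm t) / lp t) (Set.Ioc x b) +
                sInt νhplm (fun t => (lp t)⁻¹) (Set.Ioc x b)) := by
  have hle := hab.le
  obtain ⟨hlmc, hlpc, hlma, hlpm, -, -⟩ := hA3
  have hlm0 : ∀ x ∈ Icc a b, 0 < lm x := fun x hx =>
    hA6.2.trans_le (hlma hx (right_mem_Icc.2 hle) hx.2)
  have hlp0 : ∀ x ∈ Icc a b, 0 < lp x := fun x hx =>
    hA6.1.trans_le (hlpm (left_mem_Icc.2 hle) hx hx.1)
  have hip : AntitoneOn (fun x => (lp x)⁻¹) (Icc a b) := fun x hx y hy hxy =>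
    inv_anti₀ (hlp0 x hx) (hlpm hx hy hxy)
  have him : MonotoneOn (fun x => (lm x)⁻¹) (Icc a b) := fun x hx y hy hxy =>
    inv_anti₀ (hlm0 y hy) (hlma hx hy hxy)
  have hipBV := hip.boundedVariationOn_Icc
  have himBV := him.boundedVariationOn_Icc
  have hdm : BoundedVariationOn (fun x => hm x / lp x) (Icc a b) := by
    simp only [div_eq_mul_inv]
    exact hhmBV.mul hipBV
  have hdp : BoundedVariationOn (fun x => hp x / lm x) (Icc a b) := by
    simp only [div_eq_mul_inv]
    exact hhpBV.mul himBV
  have hlmBV := hlma.boundedVariationOn_Icc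
  have hlpBV := hlpm.boundedVariationOn_Icc
  have setup : ∀ νw νw' : SignedMeasure ℝ,
      (∀ s, MeasurableSet s → s ∩ Icc a b = ∅ → νw s = 0) →
      (∀ s, MeasurableSet s → s ∩ Icc a b = ∅ → νw' s = 0) →
      ∃ μ : Measure ℝ, IsFiniteMeasure μ ∧ ∃ Lm Lp Im Ip Hm Hp Dm Dp Gm Gp Wm Wp,
        InverseDensities a b μ lm lp hm hp Lm Lp Im Ip Hm Hp Dm Dp Gm Gp ∧
        HasSignedDensity μ νlm Lm ∧ HasSignedDensity μ νlp Lp ∧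
        HasSignedDensity μ νim Im ∧ HasSignedDensity μ νip Ip ∧
        HasSignedDensity μ νhmlp Dm ∧ HasSignedDensity μ νhplm Dp ∧
        HasSignedDensity μ νgm Gm ∧ HasSignedDensity μ νgp Gp ∧
        HasSignedDensity μ νw Wm ∧ HasSignedDensity μ νw' Wp := by
    intro νw νw' hνw hνw'
    obtain ⟨μ, hfin, hμ, h⟩ := exists_common_density (a := a) (b := b)
      ![νlm, νlp, νim, νip, νhm, νhp, νhmlp, νhplm, νgm, νgp, νw, νw'] (by
        simp only [Fin.forall_fin_succ]
        exact ⟨hνlm.1, hνlp.1, hνim.1, hνip.1, hνhm.1, hνhp.1, hνhmlp.1, hνhplm.1, hνgm.1,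
          hνgp.1, hνw, hνw', fun i => i.elim0⟩)
    obtain ⟨Lm, hLm⟩ : ∃ φ, HasSignedDensity μ νlm φ := h 0
    obtain ⟨Lp, hLp⟩ : ∃ φ, HasSignedDensity μ νlp φ := h 1
    obtain ⟨Im, hIm⟩ : ∃ φ, HasSignedDensity μ νim φ := h 2
    obtain ⟨Ip, hIp⟩ : ∃ φ, HasSignedDensity μ νip φ := h 3
    obtain ⟨Hm, hHm⟩ : ∃ φ, HasSignedDensity μ νhm φ := h 4
    obtain ⟨Hp, hHp⟩ : ∃ φ, HasSignedDensity μ νhp φ := h 5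
    obtain ⟨Dm, hDm⟩ : ∃ φ, HasSignedDensity μ νhmlp φ := h 6
    obtain ⟨Dp, hDp⟩ : ∃ φ, HasSignedDensity μ νhplm φ := h 7
    obtain ⟨Gm, hGm⟩ : ∃ φ, HasSignedDensity μ νgm φ := h 8
    obtain ⟨Gp, hGp⟩ : ∃ φ, HasSignedDensity μ νgp φ := h 9
    obtain ⟨Wm, hWm⟩ : ∃ φ, HasSignedDensity μ νw φ := h 10
    obtain ⟨Wp, hWp⟩ : ∃ φ, HasSignedDensity μ νw' φ := h 11
    exact ⟨μ, hfin, Lm, Lp, Im, Ip, Hm, Hp, Dm, Dp, Gm, Gp, Wm, Wp,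
      { le := hle, null := hμ, lm_cont := hlmc, lp_cont := hlpc, lm_pos := hlm0, lp_pos := hlp0
        hm_left := hhmL, hp_right := hhpR
        dlm := hLm.hasLSDensity hlmBV hνlm
        dlp := hLp.hasLSDensity hlpBV hνlp
        dim := hIm.hasLSDensity himBV hνim
        dip := hIp.hasLSDensity hipBV hνip
        dhm := hHm.hasLSDensity hhmBV hνhm
        dhp := hHp.hasLSDensity hhpBV hνhp
        dhmlp := hDm.hasLSDensity hdm hνhmlp
        dhplm := hDp.hasLSDensity hdp hνhplm
        hm_eq := hHm.ae_eq_neg_mul hGm hlmBV hμ hhm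
        hp_eq := hHp.ae_eq_neg_mul hGp hlpBV hμ hhp },
      hLm, hLp, hIm, hIp, hDm, hDp, hGm, hGp, hWm, hWp⟩
  set κ := (Gam a b lm lp νip)⁻¹ * (sInt νip (fun r => hp r / lm r) (Icc a b) +
    sInt νhmlp (fun r => (lm r)⁻¹) (Icc a b) - (hm b + hp b) / (lm b * lp b)) with hκdef
  have hnull : ∀ s : Set ℝ, MeasurableSet s → s ∩ Icc a b = ∅ → (0 : SignedMeasure ℝ) s = 0 :=
    fun _ _ _ => rfl
  have hΓ : Gam a b lm lp νip ≠ 0 := by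
    obtain ⟨μ, hfin, Lm, Lp, Im, Ip, Hm, Hp, Dm, Dp, Gm, Gp, Wm, Wp, D, -, -, -, hIp, -⟩ :=
      setup 0 0 hnull hnull
    have hI : ∀ᵐ x ∂μ, x ∈ Icc a b := by
      rw [ae_iff]
      exact D.null
    rw [Gam, hIp.sInt D.null himBV measurableSet_Icc]
    have h1 : ∫ x in Icc a b, (lm x)⁻¹ * Ip x ∂μ ≤ 0 := by
      refine integral_nonpos_of_ae (ae_restrict_of_ae ?_)
      filter_upwards [hI, D.dip.ae_nonpos_of_antitoneOn hle
        (hlpc.inv₀ fun x hx => (hlp0 x hx).ne') hip D.null] with x hx h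
      exact mul_nonpos_of_nonneg_of_nonpos (inv_nonneg.2 (hlm0 x hx).le) h
    have hb := right_mem_Icc.2 hle
    have h2 : 0 < (lm b * lp b)⁻¹ := inv_pos.2 (mul_pos (hlm0 b hb) (hlp0 b hb))
    linarith
  have hκ : ∀ (μ : Measure ℝ) (Ip Dm : ℝ → ℝ), μ (Icc a b)ᶜ = 0 → HasSignedDensity μ νip Ip →
      HasSignedDensity μ νhmlp Dm →
      (lm b * lp b)⁻¹ - ∫ x in Icc a b, (lm x)⁻¹ * Ip x ∂μ ≠ 0 ∧
      ((lm b * lp b)⁻¹ - ∫ x in Icc a b, (lm x)⁻¹ * Ip x ∂μ) * κ =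
        (∫ x in Icc a b, hp x / lm x * Ip x ∂μ) + (∫ x in Icc a b, (lm x)⁻¹ * Dm x ∂μ) -
          (hm b + hp b) / (lm b * lp b) := by
    intro μ Ip Dm hμ hIp hDm
    rw [← hIp.sInt hμ himBV measurableSet_Icc, ← hIp.sInt hμ hdp measurableSet_Icc,
      ← hDm.sInt hμ himBV measurableSet_Icc]
    exact ⟨hΓ, mul_inv_cancel_left₀ hΓ _⟩
  refine ⟨fun x => sInt νip (fun t => (κ + hp t) / lm t) (Ico a x) +
      sInt νhmlp (fun t => (lm t)⁻¹) (Ico a x),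
    fun x => -(sInt νim (fun t => (κ + hm t) / lp t) (Ioc x b) +
      sInt νhplm (fun t => (lp t)⁻¹) (Ioc x b)), ?_, ?_, fun x _ => ⟨rfl, rfl⟩⟩
  · obtain ⟨μ, hfin, Lm, Lp, Im, Ip, Hm, Hp, Dm, Dp, Gm, Gp, Wm, Wp, D, hLm, hLp, hIm, hIp, hDm,
      hDp, hGm, hGp, -, -⟩ := setup 0 0 hnull hnull
    simp only [sInt_add_sInt_eq_setIntegral_weightDensity himBV hhpBV hIp hDm D.null
        measurableSet_Ico,
      sInt_add_sInt_eq_setIntegral_weightDensity hipBV hhmBV hIm hDp D.null measurableSet_Ioc]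
    obtain ⟨hwm, hwp, heq⟩ :=
      D.hasLSDensity_and_ae_equations (hκ μ Ip Dm D.null hIp hDm).2 rfl rfl
    refine (D.invEq_iff hLm hLp hGm hGp hwm hwp ⟨hwm.bv.exists_abs_le_Icc,
      hwp.bv.exists_abs_le_Icc, hwm.bv, hwp.bv,
      fun x _ => continuousWithinAt_setIntegral_Ico hwm.int x,
      fun x _ => (continuousWithinAt_setIntegral_Ioc hwp.int x).neg, by simp, by simp⟩).2
      ⟨heq.mono fun x hx => hx.1, heq.mono fun x hx => hx.2⟩
  · intro wm wp hw
    have hw1 := hw.1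
    obtain ⟨-, -, hwmBV, hwpBV, hwmL, hwpR, hwma, hwpb⟩ := hw1
    obtain ⟨νw, hνw⟩ := hwmBV.exists_isLS hab
    obtain ⟨νw', hνw'⟩ := hwpBV.exists_isLS hab
    obtain ⟨μ, hfin, Lm, Lp, Im, Ip, Hm, Hp, Dm, Dp, Gm, Gp, Wm, Wp, D, hLm, hLp, hIm, hIp, hDm,
      hDp, hGm, hGp, hWm, hWp⟩ := setup νw νw' hνw.1 hνw'.1
    have hwm := hWm.hasLSDensity hwmBV hνw
    have hwp := hWp.hasLSDensity hwpBV hνw'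
    obtain ⟨hi, hii⟩ := (D.invEq_iff hLm hLp hGm hGp hwm hwp hw.1).1 hw
    obtain ⟨hΓ', hκ'⟩ := hκ μ Ip Dm D.null hIp hDm
    have h := D.eq_of_ae_equations hΓ' hκ' hwm hwp hwmL hwpR hwma hwpb hi hii
    simp only [sInt_add_sInt_eq_setIntegral_weightDensity himBV hhpBV hIp hDm D.null
        measurableSet_Ico,
      sInt_add_sInt_eq_setIntegral_weightDensity hipBV hhmBV hIm hDp D.null measurableSet_Ioc]
    exact ⟨fun x hx => (h x hx).1, fun x hx => (h x hx).2⟩
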